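/- There exists a C^∞ diffeomorphism f of the half-line [0,∞) with f(0)=0 and f(x)≠x for all x>0 such that: (a) the C^1-centralizer Z^1_f is the image of an injective one-parameter group, i.e. there is a complete C^1 vector field ξ on [0,∞), vanishing only at 0, whose time-1 flow is f and such that Z^1_f = { f^t : t ∈ ℝ }, where f^t denotes the time-t flow of ξ; and (b) for every r with 2 ≤ r ≤ ∞, the set T_r = { t ∈ ℝ : f^t is a C^r diffeomorphism of [0,∞) } is a proper, dense and uncountable additive subgroup of ℝ; equivalently, the centralizer Z^r_f is a proper, dense and uncountable subgroup of the one-parameter group Z^1_f. -/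

import Mathlib

open Set Filter Topology

/-- `f` is a diffeomorphism of the half-line `[0,∞)`: it fixes `0`, maps `[0,∞)` bijectively
onto itself, is differentiable (in the sense of `[0,∞)`) with everywhere positive derivative,
and its inverse is differentiable. -/
def HalfLineDiffeo (f : ℝ → ℝ) : Prop :=
  f 0 = 0 ∧ Set.BijOn f (Set.Ici 0) (Set.Ici 0) ∧
    (∀ x ∈ Set.Ici (0 : ℝ), ∃ d : ℝ, 0 < d ∧ HasDerivWithinAt f d (Set.Ici 0) x) ∧
    (∀ y ∈ Set.Ici (0 : ℝ), ∃ d : ℝ,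
      HasDerivWithinAt (Function.invFunOn f (Set.Ici 0)) d (Set.Ici 0) y)

/-- `f` is a `C^r` diffeomorphism of `[0,∞)`. -/
def CrHalfLineDiffeo (r : ℕ∞) (f : ℝ → ℝ) : Prop :=
  HalfLineDiffeo f ∧ ContDiffOn ℝ r f (Set.Ici 0)

/-- The `C^r` centralizer of `f` : all `C^r` diffeomorphisms of `[0,∞)` commuting with `f`. -/
def Centralizer (r : ℕ∞) (f : ℝ → ℝ) : Set (ℝ → ℝ) :=
  {g | CrHalfLineDiffeo r g ∧ ∀ x ∈ Set.Ici (0 : ℝ), g (f x) = f (g x)}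

/-- `F` is the (complete, globally defined) flow of the vector field `ξ` on `[0,∞)`:
`F 0 x = x` and `∂ₜ F t x = ξ (F t x)` for all `t ∈ ℝ` and `x ∈ [0,∞)`. -/
def IsFlowOf (ξ : ℝ → ℝ) (F : ℝ → ℝ → ℝ) : Prop :=
  ∀ x ∈ Set.Ici (0 : ℝ), F 0 x = x ∧
    ∀ t : ℝ, F t x ∈ Set.Ici (0 : ℝ) ∧ HasDerivAt (fun s => F s x) (ξ (F t x)) t

open scoped ContDiff

/-- All derivatives of order at most `n` of the functions `f i` are, near `+∞` and uniformly in
`i`, of size `O(exp (-m y))`. -/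
def DecaysTo {ι : Type*} (n m : ℕ) (f : ι → ℝ → ℝ) : Prop :=
  ∀ k ≤ n, ∃ C Y : ℝ, ∀ i, ∀ y ≥ Y, |iteratedDeriv k (f i) y| ≤ C * Real.exp (-(m * y))

namespace DecaysTo

variable {ι : Type*} {n m : ℕ} {f g : ι → ℝ → ℝ}

lemma mono {n' m' : ℕ} (h : DecaysTo n m f) (hn : n' ≤ n) (hm : m' ≤ m) :
    DecaysTo n' m' f := by
  intro k hk
  obtain ⟨C, Y, hC⟩ := h k (hk.trans hn)
  refine ⟨|C|, max Y 0, fun i y hy => (hC i y (le_trans (le_max_left _ _) hy)).trans ?_⟩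
  have hy0 : 0 ≤ y := le_trans (le_max_right _ _) hy
  gcongr
  exact le_abs_self C

lemma reindex {κ : Type*} (e : κ → ι) (h : DecaysTo n m f) : DecaysTo n m (fun i => f (e i)) := by
  intro k hk
  obtain ⟨C, Y, hC⟩ := h k hk
  exact ⟨C, Y, fun i => hC (e i)⟩

lemma succ_iff : DecaysTo (n + 1) m f ↔
    (∃ C Y : ℝ, ∀ i, ∀ y ≥ Y, |f i y| ≤ C * Real.exp (-(m * y))) ∧
      DecaysTo n m (fun i => deriv (f i)) := by
  constructor
  · intro h
    refine ⟨by simpa using h 0 (Nat.zero_le _), fun k hk => ?_⟩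
    obtain ⟨C, Y, hC⟩ := h (k + 1) (Nat.succ_le_succ hk)
    exact ⟨C, Y, fun i y hy => by simpa [iteratedDeriv_succ'] using hC i y hy⟩
  · rintro ⟨h0, h1⟩ k hk
    rcases k with _ | k
    · simpa using h0
    · obtain ⟨C, Y, hC⟩ := h1 k (Nat.le_of_succ_le_succ hk)
      exact ⟨C, Y, fun i y hy => by simpa [iteratedDeriv_succ'] using hC i y hy⟩

lemma zero_iff : DecaysTo 0 m f ↔
    ∃ C Y : ℝ, ∀ i, ∀ y ≥ Y, |f i y| ≤ C * Real.exp (-(m * y)) := by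
  constructor
  · intro h
    simpa using h 0 le_rfl
  · intro h k hk
    obtain rfl : k = 0 := by omega
    simpa using h

lemma add (hf : DecaysTo n m f) (hg : DecaysTo n m g)
    (hfs : ∀ i, ContDiff ℝ ∞ (f i)) (hgs : ∀ i, ContDiff ℝ ∞ (g i)) :
    DecaysTo n m (fun i y => f i y + g i y) := by
  intro k hk
  obtain ⟨C, Y, hC⟩ := hf k hk
  obtain ⟨D, Z, hD⟩ := hg k hk
  refine ⟨C + D, max Y Z, fun i y hy => ?_⟩
  rw [iteratedDeriv_fun_add ((hfs i).contDiffAt.of_le (by exact_mod_cast le_top))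
    ((hgs i).contDiffAt.of_le (by exact_mod_cast le_top)), add_mul]
  exact (abs_add_le _ _).trans (add_le_add (hC i y (le_trans (le_max_left _ _) hy))
    (hD i y (le_trans (le_max_right _ _) hy)))

lemma neg (hf : DecaysTo n m f) : DecaysTo n m (fun i y => -f i y) := by
  intro k hk
  obtain ⟨C, Y, hC⟩ := hf k hk
  refine ⟨C, Y, fun i y hy => ?_⟩
  rw [iteratedDeriv_fun_neg, abs_neg]
  exact hC i y hy

lemma sub (hf : DecaysTo n m f) (hg : DecaysTo n m g)
    (hfs : ∀ i, ContDiff ℝ ∞ (f i)) (hgs : ∀ i, ContDiff ℝ ∞ (g i)) :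
    DecaysTo n m (fun i y => f i y - g i y) := by
  simpa only [sub_eq_add_neg] using hf.add hg.neg hfs (fun i => (hgs i).neg)

lemma const (c : ℝ) (n : ℕ) : DecaysTo n 0 (fun (_ : ι) (_ : ℝ) => c) := by
  intro k _
  refine ⟨|c|, 0, fun i y _ => ?_⟩
  simp only [iteratedDeriv_const]
  split_ifs <;> simp

lemma deriv_smooth {h : ℝ → ℝ} (hs : ContDiff ℝ ∞ h) : ContDiff ℝ ∞ (deriv h) :=
  (contDiff_infty_iff_deriv.1 hs).2

lemma mul {m₁ m₂ : ℕ} (hf : DecaysTo n m₁ f) (hg : DecaysTo n m₂ g)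
    (hfs : ∀ i, ContDiff ℝ ∞ (f i)) (hgs : ∀ i, ContDiff ℝ ∞ (g i)) :
    DecaysTo n (m₁ + m₂) (fun i y => f i y * g i y) := by
  have base : ∀ {f g : ι → ℝ → ℝ},
      (∃ C Y : ℝ, ∀ i, ∀ y ≥ Y, |f i y| ≤ C * Real.exp (-(m₁ * y))) →
      (∃ C Y : ℝ, ∀ i, ∀ y ≥ Y, |g i y| ≤ C * Real.exp (-(m₂ * y))) →
      ∃ C Y : ℝ, ∀ i, ∀ y ≥ Y, |f i y * g i y| ≤ C * Real.exp (-((m₁ + m₂ : ℕ) * y)) := by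
    rintro f g ⟨C, Y, hC⟩ ⟨D, Z, hD⟩
    refine ⟨C * D, max Y Z, fun i y hy => ?_⟩
    have h1 := hC i y (le_trans (le_max_left _ _) hy)
    have h2 := hD i y (le_trans (le_max_right _ _) hy)
    rw [abs_mul]
    calc |f i y| * |g i y| ≤ (C * Real.exp (-(m₁ * y))) * (D * Real.exp (-(m₂ * y))) :=
          mul_le_mul h1 h2 (abs_nonneg _) ((abs_nonneg _).trans h1)
      _ = C * D * (Real.exp (-(m₁ * y)) * Real.exp (-(m₂ * y))) := by ring
      _ = _ := by rw [← Real.exp_add]; push_cast; ring_nf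
  induction n generalizing f g with
  | zero => exact zero_iff.2 (base (zero_iff.1 hf) (zero_iff.1 hg))
  | succ n ih =>
    obtain ⟨hf0, hf1⟩ := succ_iff.1 hf
    obtain ⟨hg0, hg1⟩ := succ_iff.1 hg
    refine succ_iff.2 ⟨base hf0 hg0, ?_⟩
    have key := (ih hf1 (hg.mono n.le_succ le_rfl) (fun i => deriv_smooth (hfs i)) hgs).add
      (ih (hf.mono n.le_succ le_rfl) hg1 hfs (fun i => deriv_smooth (hgs i)))
      (fun i => (deriv_smooth (hfs i)).mul (hgs i)) (fun i => (hfs i).mul (deriv_smooth (hgs i)))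
    convert key using 3 with i y
    exact deriv_fun_mul ((hfs i).differentiable (by simp) _) ((hgs i).differentiable (by simp) _)

lemma comp_zero {Φ : ι → ℝ → ℝ} (hf : DecaysTo 0 m f) {K : ℝ} (hK : ∀ i y, |Φ i y - y| ≤ K) :
    DecaysTo 0 m (fun i y => f i (Φ i y)) := by
  obtain ⟨C, Y, hC⟩ := zero_iff.1 hf
  refine zero_iff.2 ⟨|C| * Real.exp (m * K), Y + K, fun i y hy => ?_⟩
  have hK' := abs_le.1 (hK i y)
  refine (hC i _ (by linarith)).trans ?_
  rw [mul_assoc, ← Real.exp_add]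
  have : (m : ℝ) * (y - K) ≤ m * Φ i y := by gcongr; linarith
  gcongr
  · exact le_abs_self C
  · linarith

/-- Composition with maps at bounded distance from the identity. -/
lemma comp {Φ : ι → ℝ → ℝ} (hf : DecaysTo (n + 1) m f) (hΦ : DecaysTo n 0 (fun i => deriv (Φ i)))
    (hfs : ∀ i, ContDiff ℝ ∞ (f i)) (hΦs : ∀ i, ContDiff ℝ ∞ (Φ i))
    {K : ℝ} (hK : ∀ i y, |Φ i y - y| ≤ K) :
    DecaysTo (n + 1) m (fun i y => f i (Φ i y)) := by
  have base : ∀ {f : ι → ℝ → ℝ},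
      (∃ C Y : ℝ, ∀ i, ∀ y ≥ Y, |f i y| ≤ C * Real.exp (-(m * y))) →
      (∃ C Y : ℝ, ∀ i, ∀ y ≥ Y, |f i (Φ i y)| ≤ C * Real.exp (-(m * y))) :=
    fun h => zero_iff.1 (comp_zero (zero_iff.2 h) hK)
  have der : ∀ {f : ι → ℝ → ℝ}, (∀ i, ContDiff ℝ ∞ (f i)) →
      (fun i => deriv (fun y => f i (Φ i y))) =
        fun i y => deriv (f i) (Φ i y) * deriv (Φ i) y := by
    intro f hfs
    ext i y
    exact deriv_comp (h₂ := f i) (h := Φ i) y ((hfs i).differentiable (by simp) _)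
      ((hΦs i).differentiable (by simp) _)
  induction n generalizing f with
  | zero =>
    obtain ⟨hf0, hf1⟩ := succ_iff.1 hf
    refine succ_iff.2 ⟨base hf0, ?_⟩
    rw [der hfs]
    have h1 : DecaysTo 0 m (fun i y => deriv (f i) (Φ i y)) :=
      zero_iff.2 (base (f := fun i => deriv (f i)) (zero_iff.1 hf1))
    exact h1.mul hΦ (fun i => (deriv_smooth (hfs i)).comp (hΦs i))
      (fun i => deriv_smooth (hΦs i))
  | succ n ih =>
    obtain ⟨hf0, hf1⟩ := succ_iff.1 hf
    refine succ_iff.2 ⟨base hf0, ?_⟩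
    rw [der hfs]
    exact (ih hf1 (hΦ.mono n.le_succ le_rfl) (fun i => deriv_smooth (hfs i))).mul hΦ
      (fun i => (deriv_smooth (hfs i)).comp (hΦs i)) (fun i => deriv_smooth (hΦs i))

lemma exp (hf : DecaysTo n 0 f) (hfs : ∀ i, ContDiff ℝ ∞ (f i)) :
    DecaysTo n 0 (fun i y => Real.exp (f i y)) := by
  have base : ∃ C Y : ℝ, ∀ i, ∀ y ≥ Y, |Real.exp (f i y)| ≤ C * Real.exp (-((0 : ℕ) * y)) := by
    obtain ⟨C, Y, hC⟩ := hf 0 (Nat.zero_le _)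
    refine ⟨Real.exp C, Y, fun i y hy => ?_⟩
    have := hC i y hy
    simp only [iteratedDeriv_zero, Nat.cast_zero, zero_mul, neg_zero, Real.exp_zero,
      mul_one] at this ⊢
    rw [Real.abs_exp]
    exact Real.exp_le_exp.2 ((le_abs_self _).trans this)
  induction n with
  | zero => exact zero_iff.2 base
  | succ n ih =>
    refine succ_iff.2 ⟨base, ?_⟩
    have key := (ih (hf.mono n.le_succ le_rfl)).mul (succ_iff.1 hf).2
      (fun i => (hfs i).exp) (fun i => deriv_smooth (hfs i))
    convert key using 3 with i y
    exact _root_.deriv_exp ((hfs i).differentiable (by simp) _)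

lemma inv (hf : DecaysTo n 0 f) (hfs : ∀ i, ContDiff ℝ ∞ (f i)) {δ : ℝ} (hδ : 0 < δ)
    (hpos : ∀ i y, δ ≤ f i y) : DecaysTo n 0 (fun i y => (f i y)⁻¹) := by
  have hne : ∀ i y, f i y ≠ 0 := fun i y => (hδ.trans_le (hpos i y)).ne'
  have hs : ∀ i, ContDiff ℝ ∞ (fun y => (f i y)⁻¹) := fun i => (hfs i).inv (hne i)
  have base : ∃ C Y : ℝ, ∀ i, ∀ y ≥ Y, |(f i y)⁻¹| ≤ C * Real.exp (-((0 : ℕ) * y)) := by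
    refine ⟨δ⁻¹, 0, fun i y _ => ?_⟩
    rw [abs_of_pos (inv_pos.2 (hδ.trans_le (hpos i y)))]
    simpa using inv_anti₀ hδ (hpos i y)
  induction n with
  | zero => exact zero_iff.2 base
  | succ n ih =>
    refine succ_iff.2 ⟨base, ?_⟩
    have ih' := ih (hf.mono n.le_succ le_rfl)
    have key := ((succ_iff.1 hf).2.neg).mul (ih'.mul ih' hs hs)
      (fun i => (deriv_smooth (hfs i)).neg) (fun i => (hs i).mul (hs i))
    convert key using 3 with i y
    rw [deriv_fun_inv'' ((hfs i).differentiable (by simp) _) (hne i y)]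
    field_simp

lemma tendsto_zero {h : ℝ → ℝ} (hh : DecaysTo 0 1 (fun _ : Unit => h)) :
    Tendsto h atTop (𝓝 0) := by
  obtain ⟨C, Y, hC⟩ := zero_iff.1 hh
  refine squeeze_zero_norm' (a := fun y => C * Real.exp (-((1 : ℕ) * y))) ?_ ?_
  · filter_upwards [eventually_ge_atTop Y] with y hy
    exact hC () y hy
  · have : Tendsto (fun y : ℝ => Real.exp (-((1 : ℕ) * y))) atTop (𝓝 0) := by
      simpa using Real.tendsto_exp_neg_atTop_nhds_zero
    simpa using this.const_mul C

end DecaysTo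

/-- A smooth, positive vector field on the line, bounded by `2`. -/
structure IsSpeed (v : ℝ → ℝ) : Prop where
  smooth : ContDiff ℝ ∞ v
  pos : ∀ y, 0 < v y
  le_two : ∀ y, v y ≤ 2

/-- The time needed to travel from `0` to `y` along the vector field `v`. -/
noncomputable def clock (v : ℝ → ℝ) (y : ℝ) : ℝ := ∫ s in (0 : ℝ)..y, (v s)⁻¹

/-- The inverse function of `clock v`. -/
noncomputable def unclock (v : ℝ → ℝ) : ℝ → ℝ := Function.invFun (clock v)

/-- The flow of the vector field `v`. -/
noncomputable def flow (v : ℝ → ℝ) (σ y : ℝ) : ℝ := unclock v (clock v y + σ)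

namespace IsSpeed

variable {v : ℝ → ℝ}

lemma ne_zero (hv : IsSpeed v) (y : ℝ) : v y ≠ 0 := (hv.pos y).ne'

lemma smooth_inv (hv : IsSpeed v) : ContDiff ℝ ∞ (fun y => (v y)⁻¹) := hv.smooth.inv hv.ne_zero

lemma hasDerivAt_clock (hv : IsSpeed v) (y : ℝ) : HasDerivAt (clock v) (v y)⁻¹ y :=
  intervalIntegral.integral_hasDerivAt_right (hv.smooth_inv.continuous.intervalIntegrable _ _)
    (hv.smooth_inv.continuous.stronglyMeasurableAtFilter _ _) hv.smooth_inv.continuous.continuousAt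

lemma deriv_clock (hv : IsSpeed v) : deriv (clock v) = fun y => (v y)⁻¹ :=
  funext fun y => (hv.hasDerivAt_clock y).deriv

lemma contDiff_clock (hv : IsSpeed v) : ContDiff ℝ ∞ (clock v) := by
  refine contDiff_infty_iff_deriv.2 ⟨fun y => (hv.hasDerivAt_clock y).differentiableAt, ?_⟩
  rw [hv.deriv_clock]
  exact hv.smooth_inv

lemma strictMono_clock (hv : IsSpeed v) : StrictMono (clock v) :=
  strictMono_of_deriv_pos fun y => by
    rw [hv.deriv_clock]
    exact inv_pos.2 (hv.pos y)

lemma sub_le_mul_clock (hv : IsSpeed v) {ε y z : ℝ} (hyz : y ≤ z)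
    (hε : ∀ x ∈ Icc y z, v x ≤ ε) : z - y ≤ ε * (clock v z - clock v y) := by
  rcases hyz.eq_or_lt with rfl | hyz
  · simp
  obtain ⟨x, hx, hxe⟩ := exists_hasDerivAt_eq_slope (clock v) (fun y => (v y)⁻¹) hyz
    hv.contDiff_clock.continuous.continuousOn (fun x _ => hv.hasDerivAt_clock x)
  have h1 : clock v z - clock v y = (v x)⁻¹ * (z - y) := by
    rw [hxe, div_mul_cancel₀]
    linarith
  have h2 : z - y = v x * (clock v z - clock v y) := by
    rw [h1, mul_inv_cancel_left₀ (hv.ne_zero x)]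
  have h3 : 0 ≤ clock v z - clock v y := sub_nonneg.2 (hv.strictMono_clock.monotone hyz.le)
  calc z - y = v x * (clock v z - clock v y) := h2
    _ ≤ ε * (clock v z - clock v y) := by
      gcongr
      exact hε x (Ioo_subset_Icc_self hx)

lemma abs_sub_le_clock (hv : IsSpeed v) (y z : ℝ) : |z - y| ≤ 2 * |clock v z - clock v y| := by
  rcases le_total y z with h | h
  · rw [abs_of_nonneg (sub_nonneg.2 h),
      abs_of_nonneg (sub_nonneg.2 (hv.strictMono_clock.monotone h))]
    exact hv.sub_le_mul_clock h fun x _ => hv.le_two x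
  · rw [abs_sub_comm, abs_sub_comm (clock v z), abs_of_nonneg (sub_nonneg.2 h),
      abs_of_nonneg (sub_nonneg.2 (hv.strictMono_clock.monotone h))]
    exact hv.sub_le_mul_clock h fun x _ => hv.le_two x

lemma clock_zero : clock v 0 = 0 := by simp [clock]

lemma surjective_clock (hv : IsSpeed v) : Function.Surjective (clock v) := by
  refine hv.contDiff_clock.continuous.surjective ?_ ?_
  · refine tendsto_atTop_mono' atTop ?_ (tendsto_id.atTop_div_const (two_pos (α := ℝ)))
    filter_upwards [eventually_ge_atTop (0 : ℝ)] with y hy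
    have := hv.sub_le_mul_clock hy fun x _ => hv.le_two x
    rw [clock_zero] at this
    simp only [id]
    linarith
  · refine tendsto_atBot_mono' atBot ?_ (tendsto_id.atBot_div_const (two_pos (α := ℝ)))
    filter_upwards [eventually_le_atBot (0 : ℝ)] with y hy
    have := hv.sub_le_mul_clock hy fun x _ => hv.le_two x
    rw [clock_zero] at this
    simp only [id]
    linarith

lemma unclock_clock (hv : IsSpeed v) (y : ℝ) : unclock v (clock v y) = y :=
  Function.leftInverse_invFun hv.strictMono_clock.injective y

lemma clock_unclock (hv : IsSpeed v) (s : ℝ) : clock v (unclock v s) = s :=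
  Function.rightInverse_invFun hv.surjective_clock s

lemma contDiff_unclock (hv : IsSpeed v) : ContDiff ℝ ∞ (unclock v) := by
  set e := (hv.strictMono_clock.orderIsoOfSurjective _ hv.surjective_clock).toHomeomorph
  have he : (e.symm : ℝ → ℝ) = unclock v := by
    ext s
    apply e.injective
    rw [e.apply_symm_apply]
    exact (hv.clock_unclock s).symm
  rw [← he]
  exact e.contDiff_symm_deriv (f' := fun y => (v y)⁻¹) (fun y => inv_ne_zero (hv.ne_zero y))
    hv.hasDerivAt_clock hv.contDiff_clock

lemma hasDerivAt_unclock (hv : IsSpeed v) (s : ℝ) :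
    HasDerivAt (unclock v) (v (unclock v s)) s := by
  have h := (hv.hasDerivAt_clock (unclock v s)).of_local_left_inverse
    (hv.contDiff_unclock.continuous.continuousAt) (inv_ne_zero (hv.ne_zero _))
    (Eventually.of_forall hv.clock_unclock)
  simpa using h

lemma clock_flow (hv : IsSpeed v) (σ y : ℝ) : clock v (flow v σ y) = clock v y + σ :=
  hv.clock_unclock _

lemma flow_eq (hv : IsSpeed v) {σ y z : ℝ} (h : clock v z - clock v y = σ) : flow v σ y = z := by
  apply hv.strictMono_clock.injective
  rw [hv.clock_flow, ← h]
  ring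

lemma flow_zero (hv : IsSpeed v) (y : ℝ) : flow v 0 y = y := hv.flow_eq (sub_self _)

lemma flow_add (hv : IsSpeed v) (s t y : ℝ) : flow v (s + t) y = flow v s (flow v t y) := by
  apply hv.flow_eq
  rw [hv.clock_flow, hv.clock_flow]
  ring

lemma contDiff_flow (hv : IsSpeed v) (σ : ℝ) : ContDiff ℝ ∞ (flow v σ) :=
  hv.contDiff_unclock.comp (hv.contDiff_clock.add contDiff_const)

lemma hasDerivAt_flow_time (hv : IsSpeed v) (σ y : ℝ) :
    HasDerivAt (fun s => flow v s y) (v (flow v σ y)) σ := by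
  simpa using! (hv.hasDerivAt_unclock (clock v y + σ)).comp_const_add (clock v y) σ

lemma hasDerivAt_flow (hv : IsSpeed v) (σ y : ℝ) :
    HasDerivAt (flow v σ) (v (flow v σ y) / v y) y := by
  rw [div_eq_mul_inv]
  exact (hv.hasDerivAt_unclock (clock v y + σ)).comp y ((hv.hasDerivAt_clock y).add_const σ)

lemma abs_flow_sub_le (hv : IsSpeed v) (σ y : ℝ) : |flow v σ y - y| ≤ 2 * |σ| := by
  simpa [hv.clock_flow] using hv.abs_sub_le_clock y (flow v σ y)

lemma le_flow (hv : IsSpeed v) {σ : ℝ} (hσ : 0 ≤ σ) (y : ℝ) : y ≤ flow v σ y := by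
  rw [← hv.strictMono_clock.le_iff_le, hv.clock_flow]
  linarith

lemma flow_le (hv : IsSpeed v) {σ ε Y y : ℝ} (hσ : 0 ≤ σ) (hε : ∀ x ≥ Y, v x ≤ ε) (hy : Y ≤ y) :
    flow v σ y ≤ y + ε * σ := by
  have := hv.sub_le_mul_clock (hv.le_flow hσ y) fun x hx => hε x (hy.trans hx.1)
  rw [hv.clock_flow] at this
  linarith

end IsSpeed

/-- If travel times along `v` and `w` within an interval are related, so are the local flows. -/
lemma flow_eventuallyEq {v w : ℝ → ℝ} (hv : IsSpeed v) (hw : IsSpeed w) {A B σ τ y : ℝ}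
    (h : ∀ y ∈ Ioo A B, ∀ z ∈ Ioo A B, clock v z - clock v y = σ → clock w z - clock w y = τ)
    (hy : y ∈ Ioo A B) (hσ : flow v σ y ∈ Ioo A B) : flow w τ =ᶠ[𝓝 y] flow v σ := by
  filter_upwards [isOpen_Ioo.mem_nhds hy,
    (hv.contDiff_flow σ).continuous.continuousAt.preimage_mem_nhds (isOpen_Ioo.mem_nhds hσ)]
    with x hx hx'
  exact hw.flow_eq (h x hx _ hx' (by rw [hv.clock_flow]; ring))

/-- If `ψ` is an antiderivative of `1 / v` on an interval, it measures travel times there. -/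
lemma IsSpeed.clock_sub {v ψ : ℝ → ℝ} (hv : IsSpeed v) {A B : ℝ}
    (h : ∀ y ∈ Ioo A B, HasDerivAt ψ (v y)⁻¹ y) {y z : ℝ} (hy : y ∈ Ioo A B) (hz : z ∈ Ioo A B) :
    clock v z - clock v y = ψ z - ψ y := by
  have key := isOpen_Ioo.is_const_of_deriv_eq_zero (f := fun x => clock v x - ψ x) (s := Ioo A B)
    isPreconnected_Ioo
    (fun x hx => ((hv.hasDerivAt_clock x).sub (h x hx)).differentiableAt.differentiableWithinAt)
    (fun x hx => by simpa using ((hv.hasDerivAt_clock x).fun_sub (h x hx)).deriv) hy hz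
  linarith

lemma hasDerivAt_iteratedDeriv_translate {φ : ℝ → ℝ} (hφ : ContDiff ℝ ∞ φ) (n : ℕ) {c Z : ℝ → ℝ}
    (hc : ContDiff ℝ ∞ c) (hZ : ContDiff ℝ ∞ Z) (τ y : ℝ) :
    HasDerivAt (fun τ => iteratedDeriv n (fun y => c y * Z (φ y + τ)) y)
      (iteratedDeriv n (fun y => c y * deriv Z (φ y + τ)) y) τ := by
  induction n generalizing c Z with
  | zero =>
    have h := ((hZ.differentiable (by simp)) (φ y + τ)).hasDerivAt.comp_const_add (φ y) τ
    simpa using! h.const_mul (c y)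
  | succ n ih =>
    have hder : ∀ {W : ℝ → ℝ}, ContDiff ℝ ∞ W → ∀ τ, deriv (fun y => c y * W (φ y + τ)) =
        fun y => deriv c y * W (φ y + τ) + (c y * deriv φ y) * deriv W (φ y + τ) := by
      intro W hW τ
      ext y
      have h1 := (hc.differentiable (by simp) y).hasDerivAt
      have h2 := ((hW.differentiable (by simp)) (φ y + τ)).hasDerivAt.comp y
        ((hφ.differentiable (by simp) y).hasDerivAt.add_const τ)
      refine (h1.mul h2).deriv.trans ?_
      simp only [Function.comp]
      ring
    have hsplit : ∀ {W : ℝ → ℝ}, ContDiff ℝ ∞ W → ∀ τ,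
        iteratedDeriv (n + 1) (fun y => c y * W (φ y + τ)) y =
          iteratedDeriv n (fun y => deriv c y * W (φ y + τ)) y +
            iteratedDeriv n (fun y => (c y * deriv φ y) * deriv W (φ y + τ)) y := by
      intro W hW τ
      rw [iteratedDeriv_succ', hder hW]
      have hτ : ContDiff ℝ ∞ (fun y => φ y + τ) := hφ.add contDiff_const
      have c1 : ContDiff ℝ n (fun y => deriv c y * W (φ y + τ)) :=
        ((DecaysTo.deriv_smooth hc).mul (hW.comp hτ)).of_le (by exact_mod_cast le_top)
      have c2 : ContDiff ℝ n (fun y => (c y * deriv φ y) * deriv W (φ y + τ)) :=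
        ((hc.mul (DecaysTo.deriv_smooth hφ)).mul ((DecaysTo.deriv_smooth hW).comp hτ)).of_le
          (by exact_mod_cast le_top)
      exact iteratedDeriv_fun_add c1.contDiffAt c2.contDiffAt
    simp only [hsplit hZ, hsplit (DecaysTo.deriv_smooth hZ)]
    exact (ih (DecaysTo.deriv_smooth hc) hZ).add
      (ih (hc.mul (DecaysTo.deriv_smooth hφ)) (DecaysTo.deriv_smooth hZ))

namespace IsSpeed

variable {v : ℝ → ℝ} {T : ℝ}

/-- A decay estimate for `∂_τ (Z (φ + τ))` integrates to one for `Z (φ + τ) - Z φ`. -/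
lemma decaysTo_sub (hv : IsSpeed v) {n m : ℕ} {Z : ℝ → ℝ} (hZ : ContDiff ℝ ∞ Z)
    (h : DecaysTo n m (fun (τ : Icc (-T) T) y => deriv Z (clock v y + τ))) :
    DecaysTo n m (fun (τ : Icc (-T) T) y => Z (clock v y + τ) - Z (clock v y)) := by
  intro k hk
  obtain ⟨C, Y, hC⟩ := h k hk
  refine ⟨T * C, Y, fun τ y hy => ?_⟩
  have hT : 0 ≤ T := by linarith [τ.2.1, τ.2.2]
  have hd := fun τ : ℝ => hasDerivAt_iteratedDeriv_translate hv.contDiff_clock k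
    (contDiff_const (c := (1 : ℝ))) hZ τ y
  simp only [one_mul] at hd
  have hs : ∀ τ : ℝ, ContDiff ℝ k (fun y => Z (clock v y + τ)) := fun τ =>
    (hZ.comp (hv.contDiff_clock.add contDiff_const)).of_le (by exact_mod_cast le_top)
  have hs0 : ContDiff ℝ k (fun y => Z (clock v y)) :=
    (hZ.comp hv.contDiff_clock).of_le (by exact_mod_cast le_top)
  rw [iteratedDeriv_fun_sub (hs τ).contDiffAt hs0.contDiffAt]
  have key := (convex_Icc (-T) T).norm_image_sub_le_of_norm_hasDerivWithin_le
    (fun τ _ => (hd τ).hasDerivWithinAt) (fun σ hσ => hC ⟨σ, hσ⟩ y hy)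
    (show (0 : ℝ) ∈ Icc (-T) T from ⟨by linarith, hT⟩) τ.2
  simp only [add_zero, sub_zero, Real.norm_eq_abs] at key
  refine key.trans ?_
  have h0 : 0 ≤ C * Real.exp (-(m * y)) := (abs_nonneg _).trans (hC ⟨0, by linarith, hT⟩ y hy)
  calc C * Real.exp (-(m * y)) * |(τ : ℝ)| ≤ C * Real.exp (-(m * y)) * T := by
        gcongr
        exact abs_le.2 τ.2
    _ = T * C * Real.exp (-(m * y)) := by ring

/-- The flow of a rapidly decaying vector field is rapidly asymptotic to the identity. -/
lemma decaysTo_flow (hv : IsSpeed v) (hd : ∀ n m, DecaysTo n m (fun _ : Unit => v)) (T : ℝ)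
    (n m : ℕ) : DecaysTo n 0 (fun (τ : Icc (-T) T) => deriv (flow v τ)) ∧
      DecaysTo n m (fun (τ : Icc (-T) T) y => flow v τ y - y) := by
  have hK : ∀ (τ : Icc (-T) T) y, |flow v τ y - y| ≤ 2 * T := fun τ y =>
    (hv.abs_flow_sub_le τ y).trans (by gcongr; exact abs_le.2 τ.2)
  have hΦs : ∀ τ : Icc (-T) T, ContDiff ℝ ∞ (flow v τ) := fun τ => hv.contDiff_flow τ
  have hv' := DecaysTo.deriv_smooth hv.smooth
  set p : Icc (-T) T → ℝ → ℝ := fun τ y => Real.log (v (flow v τ y)) - Real.log (v y) with hp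
  have hps : ∀ τ, ContDiff ℝ ∞ (p τ) := fun τ =>
    ((hv.smooth.comp (hΦs τ)).log fun y => hv.ne_zero _).sub (hv.smooth.log hv.ne_zero)
  have hpexp : ∀ τ : Icc (-T) T, deriv (flow v τ) = fun y => Real.exp (p τ y) := by
    intro τ
    ext y
    rw [(hv.hasDerivAt_flow τ y).deriv, hp]
    simp only
    rw [Real.exp_sub, Real.exp_log (hv.pos _), Real.exp_log (hv.pos _)]
  have hZ : ContDiff ℝ ∞ (fun s => Real.log (v (unclock v s))) :=
    (hv.smooth.comp hv.contDiff_unclock).log fun s => hv.ne_zero _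
  have hZ' : deriv (fun s => Real.log (v (unclock v s))) = fun s => deriv v (unclock v s) := by
    ext s
    have h1 := (hv.smooth.differentiable (by simp) (unclock v s)).hasDerivAt.comp s
      (hv.hasDerivAt_unclock s)
    have h2 := h1.log (hv.ne_zero _)
    refine h2.deriv.trans ?_
    simp only [Function.comp]
    rw [mul_div_assoc, div_self (hv.ne_zero _), mul_one]
  have step : ∀ n m, DecaysTo n m (fun (τ : Icc (-T) T) y => deriv v (flow v τ y)) →
      DecaysTo n m p := by
    intro n m h
    have := hv.decaysTo_sub (T := T) hZ (n := n) (m := m) (by rw [hZ']; exact h)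
    simp only [hv.unclock_clock] at this
    exact this
  have hvd : ∀ n m, DecaysTo n m (fun _ : Icc (-T) T => deriv v) := fun n m =>
    ((DecaysTo.succ_iff.1 (hd (n + 1) m)).2).reindex (fun _ => ())
  have hpd : ∀ n m, DecaysTo n m p := by
    intro n
    induction n with
    | zero => exact fun m => step 0 m ((hvd 0 m).comp_zero hK)
    | succ n ih =>
      intro m
      refine step _ _ ((hvd (n + 1) m).comp ?_ (fun _ => hv') hΦs hK)
      simp only [hpexp]
      exact (ih 0).exp hps
  have h1 : ∀ n, DecaysTo n 0 (fun (τ : Icc (-T) T) => deriv (flow v τ)) := by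
    intro n
    simp only [hpexp]
    exact (hpd n 0).exp hps
  refine ⟨h1 n, ?_⟩
  have h2 : DecaysTo (n + 1) m (fun (τ : Icc (-T) T) y => v (flow v τ y)) :=
    ((hd (n + 1) m).reindex (fun _ : Icc (-T) T => ())).comp (h1 n) (fun _ => hv.smooth) hΦs hK
  have hu : deriv (unclock v) = fun s => v (unclock v s) :=
    funext fun s => (hv.hasDerivAt_unclock s).deriv
  have := hv.decaysTo_sub (T := T) hv.contDiff_unclock (n := n) (m := m)
    (by rw [hu]; exact h2.mono n.le_succ le_rfl)
  simp only [hv.unclock_clock] at this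
  exact this

end IsSpeed

/-- The function `x ↦ x * G (-log x)` on the half-line, extended by `x ↦ L * x`. -/
noncomputable def germ (L : ℝ) (G : ℝ → ℝ) (x : ℝ) : ℝ :=
  if x ≤ 0 then L * x else x * G (-Real.log x)

section Germ

variable {L : ℝ} {G : ℝ → ℝ}

lemma germ_of_nonpos {x : ℝ} (hx : x ≤ 0) : germ L G x = L * x := if_pos hx

lemma germ_of_pos {x : ℝ} (hx : 0 < x) : germ L G x = x * G (-Real.log x) := if_neg hx.not_ge

lemma tendsto_neg_log : Tendsto (fun x => -Real.log x) (𝓝[>] 0) atTop :=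
  tendsto_neg_atBot_atTop.comp Real.tendsto_log_nhdsGT_zero

lemma tendsto_if_neg_log (hG : Tendsto G atTop (𝓝 L)) :
    Tendsto (fun x => if x ≤ 0 then L else G (-Real.log x)) (𝓝 0) (𝓝 L) := by
  rw [← nhdsLE_sup_nhdsGT, tendsto_sup]
  constructor
  · refine tendsto_const_nhds.congr' ?_
    filter_upwards [self_mem_nhdsWithin] with x hx
    exact (if_pos hx).symm
  · refine (hG.comp tendsto_neg_log).congr' ?_
    filter_upwards [self_mem_nhdsWithin] with x hx
    exact (if_neg (not_le.2 hx)).symm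

lemma hasDerivAt_germ_zero (hG : Tendsto G atTop (𝓝 L)) : HasDerivAt (germ L G) L 0 := by
  rw [hasDerivAt_iff_tendsto_slope]
  refine ((tendsto_if_neg_log hG).mono_left nhdsWithin_le_nhds).congr' ?_
  filter_upwards [self_mem_nhdsWithin] with x hx
  have hx0 : x ≠ 0 := hx
  rw [slope_def_field, germ_of_nonpos le_rfl, germ]
  split_ifs
  · field_simp
  · field_simp
    ring

lemma hasDerivAt_germ_of_neg {x : ℝ} (hx : x < 0) : HasDerivAt (germ L G) L x := by
  have h : HasDerivAt (fun x => L * x) L x := by simpa using (hasDerivAt_id x).const_mul L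
  refine h.congr_of_eventuallyEq ?_
  filter_upwards [Iio_mem_nhds hx] with z hz
  exact germ_of_nonpos (le_of_lt hz)

lemma hasDerivAt_germ_of_pos {x g : ℝ} (hx : 0 < x) (hG : HasDerivAt G g (-Real.log x)) :
    HasDerivAt (germ L G) (G (-Real.log x) - g) x := by
  have h := (hasDerivAt_id x).mul (hG.comp x (Real.hasDerivAt_log hx.ne').neg)
  refine (h.congr_of_eventuallyEq ?_).congr_deriv ?_
  · filter_upwards [Ioi_mem_nhds hx] with z hz
    simp [germ_of_pos hz]
  · simp only [id, Function.comp, Pi.neg_apply]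
    field_simp
    ring

lemma hasDerivAt_germ (hG : Tendsto G atTop (𝓝 L)) (hs : Differentiable ℝ G) (x : ℝ) :
    HasDerivAt (germ L G) (if x ≤ 0 then L else (G - deriv G) (-Real.log x)) x := by
  rcases lt_trichotomy x 0 with hx | rfl | hx
  · simpa [hx.le] using hasDerivAt_germ_of_neg hx
  · simpa using hasDerivAt_germ_zero hG
  · simpa [hx.not_ge] using hasDerivAt_germ_of_pos hx (hs _).hasDerivAt

lemma contDiff_one_germ (hG : Tendsto G atTop (𝓝 L)) (hG' : Tendsto (deriv G) atTop (𝓝 0))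
    (hs : ContDiff ℝ 1 G) : ContDiff ℝ 1 (germ L G) := by
  have hd := hs.differentiable (by simp)
  have hsub : Continuous (G - deriv G) := hs.continuous.sub (hs.continuous_deriv le_rfl)
  refine contDiff_one_iff_deriv.2 ⟨fun x => (hasDerivAt_germ hG hd x).differentiableAt, ?_⟩
  rw [funext fun x => (hasDerivAt_germ hG hd x).deriv, continuous_iff_continuousAt]
  intro x
  rcases lt_trichotomy x 0 with hx | rfl | hx
  · refine continuousAt_const.congr (f := fun _ => L) ?_
    filter_upwards [Iio_mem_nhds hx] with z hz
    exact (if_pos (le_of_lt hz)).symm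
  · have : Tendsto (G - deriv G) atTop (𝓝 L) := by simpa using! hG.sub hG'
    simpa [ContinuousAt] using tendsto_if_neg_log this
  · have : ContinuousAt (fun x => (G - deriv G) (-Real.log x)) x :=
      hsub.continuousAt.comp (Real.continuousAt_log hx.ne').neg
    refine this.congr ?_
    filter_upwards [Ioi_mem_nhds hx] with z hz
    exact (if_neg (not_le.2 hz)).symm

lemma DecaysTo.exp_mul {ι : Type*} {f : ι → ℝ → ℝ} {n m : ℕ} (hf : DecaysTo n (m + 1) f)
    (hs : ∀ i, ContDiff ℝ ∞ (f i)) : DecaysTo n m (fun i y => Real.exp y * f i y) := by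
  have base : ∀ {f : ι → ℝ → ℝ}, DecaysTo 0 (m + 1) f →
      DecaysTo 0 m (fun i y => Real.exp y * f i y) := by
    intro f hf
    obtain ⟨C, Y, hC⟩ := DecaysTo.zero_iff.1 hf
    refine DecaysTo.zero_iff.2 ⟨C, Y, fun i y hy => ?_⟩
    rw [abs_mul, Real.abs_exp]
    calc Real.exp y * |f i y| ≤ Real.exp y * (C * Real.exp (-((m + 1 : ℕ) * y))) := by
          gcongr
          exact hC i y hy
      _ = C * (Real.exp y * Real.exp (-((m + 1 : ℕ) * y))) := by ring
      _ = C * Real.exp (-(m * y)) := by rw [← Real.exp_add]; push_cast; ring_nf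
  induction n generalizing f with
  | zero => exact base hf
  | succ n ih =>
    refine DecaysTo.succ_iff.2 ⟨DecaysTo.zero_iff.1 (base (hf.mono (Nat.zero_le _) le_rfl)), ?_⟩
    have hs' := fun i => DecaysTo.deriv_smooth (hs i)
    have key := ih ((hf.mono n.le_succ le_rfl).add (DecaysTo.succ_iff.1 hf).2 hs hs')
      (fun i => (hs i).add (hs' i))
    convert key using 3 with i y
    refine ((Real.hasDerivAt_exp y).mul
      ((hs i).differentiable (by simp) y).hasDerivAt).deriv.trans ?_
    ring

lemma contDiff_germ_zero (hs : ContDiff ℝ ∞ G) (hd : ∀ n m, DecaysTo n m (fun _ : Unit => G)) :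
    ContDiff ℝ ∞ (germ 0 G) := by
  refine contDiff_infty.2 fun n => ?_
  have hdiff : ∀ {G : ℝ → ℝ}, ContDiff ℝ ∞ G → (∀ n m, DecaysTo n m (fun _ : Unit => G)) →
      ∀ x, HasDerivAt (germ 0 G) (germ 0 (fun y => Real.exp y * (G y - deriv G y)) x) x := by
    intro G hs hd x
    refine (hasDerivAt_germ (hd 0 1).tendsto_zero (hs.differentiable (by simp)) x).congr_deriv ?_
    rw [germ]
    split_ifs with hx
    · simp
    · have hx' := not_le.1 hx
      rw [Real.exp_neg, Real.exp_log hx', Pi.sub_apply, mul_inv_cancel_left₀ hx'.ne']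
  induction n generalizing G with
  | zero =>
    exact contDiff_zero.2 (Differentiable.continuous fun x => (hdiff hs hd x).differentiableAt)
  | succ n ih =>
    push_cast
    refine contDiff_succ_iff_deriv.2 ⟨fun x => (hdiff hs hd x).differentiableAt, by simp, ?_⟩
    rw [funext fun x => (hdiff hs hd x).deriv]
    have hs' := DecaysTo.deriv_smooth hs
    refine ih (Real.contDiff_exp.mul (hs.sub hs')) fun n m => ?_
    exact ((hd n (m + 1)).sub (DecaysTo.succ_iff.1 (hd (n + 1) (m + 1))).2 (fun _ => hs)
      (fun _ => hs')).exp_mul (fun _ => hs.sub hs')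

end Germ

lemma tendsto_sub_of_deriv_tendsto_zero {Z u : ℝ → ℝ} (hZ : Differentiable ℝ Z)
    (hZ' : Tendsto (deriv Z) atTop (𝓝 0)) {K : ℝ} (hu : ∀ s, |u s - s| ≤ K) :
    Tendsto (fun s => Z (u s) - Z s) atTop (𝓝 0) := by
  have hK : 0 ≤ K := (abs_nonneg _).trans (hu 0)
  rw [Metric.tendsto_atTop]
  intro ε hε
  obtain ⟨R, hR⟩ := Metric.tendsto_atTop.1 hZ' (ε / (K + 1)) (by positivity)
  refine ⟨R + K, fun s hs => ?_⟩
  have h1 := abs_le.1 (hu s)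
  have key := (convex_Ici R).norm_image_sub_le_of_norm_deriv_le (f := Z)
    (fun x _ => hZ x) (C := ε / (K + 1))
    (fun x hx => by simpa using (hR x hx).le) (show s ∈ Ici R by simp; linarith)
    (show u s ∈ Ici R by simp; linarith)
  rw [dist_zero_right]
  refine key.trans_lt ?_
  rw [Real.norm_eq_abs]
  calc ε / (K + 1) * |u s - s| ≤ ε / (K + 1) * K := by gcongr; exact hu s
    _ < ε / (K + 1) * (K + 1) := by gcongr; linarith
    _ = ε := by field_simp

/-- A speed tending to zero at `+∞` together with its derivative. -/
structure IsFadingSpeed (v : ℝ → ℝ) : Prop extends IsSpeed v where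
  tendsto : Tendsto v atTop (𝓝 0)
  tendsto_deriv : Tendsto (deriv v) atTop (𝓝 0)

/-- The flow of `v` in the coordinate `x = exp (-y)` of the half-line. -/
noncomputable def halfFlow (v : ℝ → ℝ) (t : ℝ) : ℝ → ℝ :=
  germ 1 fun y => Real.exp (y - flow v t y)

namespace IsSpeed

variable {v : ℝ → ℝ}

lemma halfFlow_of_nonpos {t x : ℝ} (hx : x ≤ 0) : halfFlow v t x = x := by
  rw [halfFlow, germ_of_nonpos hx, one_mul]

lemma halfFlow_exp (t y : ℝ) : halfFlow v t (Real.exp (-y)) = Real.exp (-flow v t y) := by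
  rw [halfFlow, germ_of_pos (Real.exp_pos _), Real.log_exp, neg_neg, ← Real.exp_add]
  ring_nf

lemma halfFlow_of_pos {t x : ℝ} (hx : 0 < x) :
    halfFlow v t x = Real.exp (-flow v t (-Real.log x)) := by
  rw [← halfFlow_exp, neg_neg, Real.exp_log hx]

lemma halfFlow_pos {t x : ℝ} (hx : 0 < x) : 0 < halfFlow v t x := by
  rw [halfFlow_of_pos hx]
  exact Real.exp_pos _

lemma mapsTo_halfFlow (t : ℝ) : MapsTo (halfFlow v t) (Ici 0) (Ici 0) := by
  intro x hx
  rcases (mem_Ici.1 hx).eq_or_lt with rfl | hx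
  · rw [halfFlow_of_nonpos le_rfl]
    exact self_mem_Ici
  · exact (halfFlow_pos hx).le

lemma halfFlow_zero (hv : IsSpeed v) (x : ℝ) : halfFlow v 0 x = x := by
  rcases le_or_gt x 0 with hx | hx
  · exact halfFlow_of_nonpos hx
  · rw [halfFlow_of_pos hx, hv.flow_zero, neg_neg, Real.exp_log hx]

lemma halfFlow_add (hv : IsSpeed v) (s t x : ℝ) :
    halfFlow v (s + t) x = halfFlow v s (halfFlow v t x) := by
  rcases le_or_gt x 0 with hx | hx
  · simp only [halfFlow_of_nonpos hx]
  · rw [halfFlow_of_pos hx, halfFlow_of_pos hx, halfFlow_exp, hv.flow_add]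

lemma halfFlow_neg_halfFlow (hv : IsSpeed v) (t x : ℝ) :
    halfFlow v (-t) (halfFlow v t x) = x := by
  rw [← hv.halfFlow_add, neg_add_cancel, hv.halfFlow_zero]

lemma halfFlow_halfFlow_neg (hv : IsSpeed v) (t x : ℝ) :
    halfFlow v t (halfFlow v (-t) x) = x := by
  rw [← hv.halfFlow_add, add_neg_cancel, hv.halfFlow_zero]

lemma bijOn_halfFlow (hv : IsSpeed v) (t : ℝ) : BijOn (halfFlow v t) (Ici 0) (Ici 0) :=
  BijOn.mk (mapsTo_halfFlow t)
    (Function.LeftInverse.injective (hv.halfFlow_neg_halfFlow t)).injOn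
    fun x hx => ⟨halfFlow v (-t) x, mapsTo_halfFlow _ hx, hv.halfFlow_halfFlow_neg t x⟩

lemma hasDerivAt_exp_sub_flow (hv : IsSpeed v) (t y : ℝ) :
    HasDerivAt (fun y => Real.exp (y - flow v t y))
      (Real.exp (y - flow v t y) * (1 - v (flow v t y) / v y)) y :=
  ((hasDerivAt_id y).sub (hv.hasDerivAt_flow t y)).exp

lemma hasDerivAt_halfFlow_exp (hv : IsSpeed v) (t y : ℝ) :
    HasDerivAt (halfFlow v t) (Real.exp (y - flow v t y) * (v (flow v t y) / v y))
      (Real.exp (-y)) := by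
  have h := hasDerivAt_germ_of_pos (L := 1) (Real.exp_pos (-y))
    (G := fun y => Real.exp (y - flow v t y))
    (by rw [Real.log_exp, neg_neg]; exact hv.hasDerivAt_exp_sub_flow t y)
  refine h.congr_deriv ?_
  simp only [Real.log_exp, neg_neg]
  ring

end IsSpeed

lemma IsSpeed.hasDerivAt_log_unclock {v : ℝ → ℝ} (hv : IsSpeed v) (s : ℝ) :
    HasDerivAt (fun s => Real.log (v (unclock v s))) (deriv v (unclock v s)) s := by
  have h := ((hv.smooth.differentiable (by simp) (unclock v s)).hasDerivAt.comp s
    (hv.hasDerivAt_unclock s)).log (hv.ne_zero _)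
  refine h.congr_deriv ?_
  simp only [Function.comp]
  rw [mul_div_assoc, div_self (hv.ne_zero _), mul_one]

lemma IsSpeed.tendsto_clock {v : ℝ → ℝ} (hv : IsSpeed v) : Tendsto (clock v) atTop atTop :=
  hv.strictMono_clock.monotone.tendsto_atTop_atTop fun b =>
    (hv.surjective_clock b).imp fun _ h => h.ge

lemma IsSpeed.tendsto_unclock {v : ℝ → ℝ} (hv : IsSpeed v) : Tendsto (unclock v) atTop atTop :=
  tendsto_atTop.2 fun b => by
    filter_upwards [eventually_ge_atTop (clock v b)] with s hs
    rwa [← hv.strictMono_clock.le_iff_le, hv.clock_unclock]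

namespace IsFadingSpeed

variable {v : ℝ → ℝ}

/-- The speed is asymptotically constant along orbits. -/
lemma tendsto_div (hv : IsFadingSpeed v) {h : ℝ → ℝ} {K : ℝ}
    (hK : ∀ y, |clock v (h y) - clock v y| ≤ K) :
    Tendsto (fun y => v (h y) / v y) atTop (𝓝 1) := by
  have hs := hv.toIsSpeed
  have h1 := tendsto_sub_of_deriv_tendsto_zero
    (Z := fun s => Real.log (v (unclock v s))) (u := fun s => clock v (h (unclock v s)))
    (fun s => (hs.hasDerivAt_log_unclock s).differentiableAt)
    (by
      rw [funext fun s => (hs.hasDerivAt_log_unclock s).deriv]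
      exact hv.tendsto_deriv.comp hs.tendsto_unclock)
    (K := K) (fun s => by simpa [hs.clock_unclock] using hK (unclock v s))
  have h2 := (Real.continuous_exp.tendsto 0).comp (h1.comp hs.tendsto_clock)
  rw [Real.exp_zero] at h2
  refine h2.congr fun y => ?_
  simp only [Function.comp, hs.unclock_clock]
  rw [Real.exp_sub, Real.exp_log (hs.pos _), Real.exp_log (hs.pos _)]

lemma tendsto_flow_sub (hv : IsFadingSpeed v) (t : ℝ) :
    Tendsto (fun y => flow v t y - y) atTop (𝓝 0) := by
  have hs := hv.toIsSpeed
  have h1 := tendsto_sub_of_deriv_tendsto_zero (Z := unclock v) (u := fun s => s + t)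
    (hs.contDiff_unclock.differentiable (by simp))
    (by
      rw [funext fun s => (hs.hasDerivAt_unclock s).deriv]
      exact hv.tendsto.comp hs.tendsto_unclock)
    (K := |t|) (fun s => by simp)
  refine (h1.comp hs.tendsto_clock).congr fun y => ?_
  simp only [Function.comp, hs.unclock_clock, flow]

lemma tendsto_exp_sub_flow (hv : IsFadingSpeed v) (t : ℝ) :
    Tendsto (fun y => Real.exp (y - flow v t y)) atTop (𝓝 1) := by
  have := (Real.continuous_exp.tendsto 0).comp
    (by simpa using (hv.tendsto_flow_sub t).neg : Tendsto (fun y => y - flow v t y) atTop (𝓝 0))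
  rwa [Real.exp_zero] at this

lemma contDiff_halfFlow (hv : IsFadingSpeed v) (t : ℝ) : ContDiff ℝ 1 (halfFlow v t) := by
  have hs := hv.toIsSpeed
  refine contDiff_one_germ (hv.tendsto_exp_sub_flow t) ?_
    (((contDiff_id.sub (hs.contDiff_flow t)).exp).of_le (by exact_mod_cast le_top))
  rw [funext fun y => (hs.hasDerivAt_exp_sub_flow t y).deriv]
  have h := hv.tendsto_div (h := flow v t) (K := |t|) fun y => by
    rw [hs.clock_flow, add_sub_cancel_left]
  simpa using (hv.tendsto_exp_sub_flow t).mul (h.const_sub 1)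

lemma hasDerivAt_halfFlow_zero (hv : IsFadingSpeed v) (t : ℝ) :
    HasDerivAt (halfFlow v t) 1 0 := hasDerivAt_germ_zero (hv.tendsto_exp_sub_flow t)

lemma deriv_halfFlow_pos (hv : IsFadingSpeed v) (t : ℝ) {x : ℝ} (hx : 0 ≤ x) :
    0 < deriv (halfFlow v t) x := by
  rcases hx.eq_or_lt with rfl | hx
  · rw [(hv.hasDerivAt_halfFlow_zero t).deriv]
    exact one_pos
  · obtain ⟨y, rfl⟩ : ∃ y, Real.exp (-y) = x := ⟨-Real.log x, by rw [neg_neg, Real.exp_log hx]⟩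
    rw [(hv.toIsSpeed.hasDerivAt_halfFlow_exp t y).deriv]
    exact mul_pos (Real.exp_pos _) (div_pos (hv.pos _) (hv.pos _))

lemma hasDerivAt_halfFlow (hv : IsFadingSpeed v) (t x : ℝ) :
    HasDerivAt (halfFlow v t) (deriv (halfFlow v t) x) x :=
  ((hv.contDiff_halfFlow t).differentiable (by simp) x).hasDerivAt

lemma halfLineDiffeo (hv : IsFadingSpeed v) (t : ℝ) : HalfLineDiffeo (halfFlow v t) := by
  have hs := hv.toIsSpeed
  refine ⟨IsSpeed.halfFlow_of_nonpos le_rfl, hs.bijOn_halfFlow t, fun x hx =>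
    ⟨_, hv.deriv_halfFlow_pos t hx, (hv.hasDerivAt_halfFlow t x).hasDerivWithinAt⟩, fun y hy =>
    ⟨_, (hv.hasDerivAt_halfFlow (-t) y).hasDerivWithinAt.congr_of_mem ?_ hy⟩⟩
  intro z hz
  obtain ⟨x, hx, rfl⟩ := (hs.bijOn_halfFlow t).surjOn hz
  rw [(hs.bijOn_halfFlow t).injOn.leftInvOn_invFunOn hx, hs.halfFlow_neg_halfFlow]

lemma contDiffOn_halfFlow_neg (hv : IsFadingSpeed v) {t : ℝ} {n : ℕ}
    (h : ContDiffOn ℝ n (halfFlow v t) (Ici 0)) : ContDiffOn ℝ n (halfFlow v (-t)) (Ici 0) := by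
  have hs := hv.toIsSpeed
  have hd : ∀ t, EqOn (derivWithin (halfFlow v t) (Ici 0)) (deriv (halfFlow v t)) (Ici 0) :=
    fun t x hx => (hv.hasDerivAt_halfFlow t x).hasDerivWithinAt.derivWithin
      (uniqueDiffOn_Ici 0 x hx)
  induction n with
  | zero => exact contDiffOn_zero.2 (hv.contDiff_halfFlow _).continuous.continuousOn
  | succ n ih =>
    have ih' := ih (h.of_le (by exact_mod_cast n.le_succ))
    push_cast at h ⊢
    rw [contDiffOn_succ_iff_derivWithin (uniqueDiffOn_Ici 0)] at h ⊢
    refine ⟨((hv.contDiff_halfFlow _).differentiable (by simp)).differentiableOn, by simp, ?_⟩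
    have hf' : ContDiffOn ℝ n (deriv (halfFlow v t)) (Ici 0) :=
      h.2.2.congr fun x hx => (hd t hx).symm
    refine ((hf'.comp ih' (IsSpeed.mapsTo_halfFlow _)).inv fun x hx =>
      (hv.deriv_halfFlow_pos t (IsSpeed.mapsTo_halfFlow _ hx)).ne').congr fun x hx => ?_
    rw [hd _ hx]
    have key := ((hv.hasDerivAt_halfFlow t (halfFlow v (-t) x)).comp x
      (hv.hasDerivAt_halfFlow (-t) x)).deriv
    have hid : halfFlow v t ∘ halfFlow v (-t) = id := funext (hs.halfFlow_halfFlow_neg t)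
    rw [hid, deriv_id] at key
    exact eq_inv_of_mul_eq_one_right key.symm

/-- The times at which the flow is of class `C^r`. -/
def smoothTimes (hv : IsFadingSpeed v) (r : ℕ∞) : AddSubgroup ℝ where
  carrier := {t | CrHalfLineDiffeo r (halfFlow v t)}
  zero_mem' := ⟨hv.halfLineDiffeo 0,
    contDiffOn_id.congr fun x _ => hv.toIsSpeed.halfFlow_zero x⟩
  add_mem' := fun {s t} hs ht => ⟨hv.halfLineDiffeo _,
    (hs.2.comp ht.2 (IsSpeed.mapsTo_halfFlow t)).congr fun x _ => hv.toIsSpeed.halfFlow_add s t x⟩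
  neg_mem' := fun {t} ht => ⟨hv.halfLineDiffeo _, by
    rw [contDiffOn_iff_forall_nat_le]
    intro n hn
    exact hv.contDiffOn_halfFlow_neg (ht.2.of_le (by exact_mod_cast hn))⟩

end IsFadingSpeed

/-- The vector field on the half-line with flow `halfFlow v`. -/
noncomputable def halfField (v : ℝ → ℝ) : ℝ → ℝ := germ 0 fun y => -v y

lemma HalfLineDiffeo.congr {f g : ℝ → ℝ} (hf : HalfLineDiffeo f) (h : EqOn g f (Ici 0)) :
    HalfLineDiffeo g := by
  obtain ⟨h0, hbij, hd, hi⟩ := hf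
  have hbij' := hbij.congr h.symm
  refine ⟨(h self_mem_Ici).trans h0, hbij', fun x hx => ?_, fun y hy => ?_⟩
  · obtain ⟨d, hd0, hd⟩ := hd x hx
    exact ⟨d, hd0, hd.congr_of_mem h hx⟩
  · obtain ⟨d, hd⟩ := hi y hy
    refine ⟨d, hd.congr_of_mem (fun z hz => ?_) hy⟩
    obtain ⟨x, hx, rfl⟩ := hbij.surjOn hz
    rw [hbij.injOn.leftInvOn_invFunOn hx, ← h hx, hbij'.injOn.leftInvOn_invFunOn hx]

lemma CrHalfLineDiffeo.congr {r : ℕ∞} {f g : ℝ → ℝ} (hf : CrHalfLineDiffeo r f)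
    (h : EqOn g f (Ici 0)) : CrHalfLineDiffeo r g :=
  ⟨hf.1.congr h, hf.2.congr h⟩

lemma eq_of_tendsto_of_periodic {H : ℝ → ℝ} {l : ℝ} (hH : Tendsto H atTop (𝓝 l))
    (hp : ∀ s, H (s + 1) = H s) (s : ℝ) : H s = l := by
  have h1 : ∀ n : ℕ, H (s + n) = H s := by
    intro n
    induction n with
    | zero => simp
    | succ n ih => rw [Nat.cast_succ, ← add_assoc, hp, ih]
  have h2 := hH.comp (tendsto_atTop_add_const_left atTop s tendsto_natCast_atTop_atTop)
  exact tendsto_nhds_unique (tendsto_const_nhds.congr fun n => (h1 n).symm) h2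

namespace IsFadingSpeed

variable {v : ℝ → ℝ}

lemma contDiff_halfField (hv : IsFadingSpeed v) : ContDiff ℝ 1 (halfField v) := by
  refine contDiff_one_germ (by simpa using hv.tendsto.neg) ?_
    (hv.smooth.neg.of_le (by exact_mod_cast le_top))
  rw [deriv.fun_neg']
  simpa using hv.tendsto_deriv.neg

lemma halfField_zero : halfField v 0 = 0 := by
  rw [halfField, germ_of_nonpos le_rfl, zero_mul]

lemma halfField_exp (y : ℝ) : halfField v (Real.exp (-y)) = Real.exp (-y) * -v y := by
  rw [halfField, germ_of_pos (Real.exp_pos _), Real.log_exp, neg_neg]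

lemma halfField_ne_zero (hv : IsFadingSpeed v) {x : ℝ} (hx : 0 < x) : halfField v x ≠ 0 := by
  rw [halfField, germ_of_pos hx]
  exact mul_ne_zero hx.ne' (neg_ne_zero.2 (hv.toIsSpeed.ne_zero _))

lemma isFlowOf (hv : IsFadingSpeed v) : IsFlowOf (halfField v) (halfFlow v) := by
  have hs := hv.toIsSpeed
  intro x hx
  refine ⟨hs.halfFlow_zero x, fun t => ⟨IsSpeed.mapsTo_halfFlow t hx, ?_⟩⟩
  rcases (mem_Ici.1 hx).eq_or_lt with rfl | hx
  · simp only [IsSpeed.halfFlow_of_nonpos le_rfl, halfField_zero]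
    exact hasDerivAt_const t 0
  · simp only [IsSpeed.halfFlow_of_pos hx, halfField_exp]
    exact (hs.hasDerivAt_flow_time t _).neg.exp

lemma halfFlow_injective (hv : IsFadingSpeed v) {s t : ℝ}
    (h : EqOn (halfFlow v s) (halfFlow v t) (Ici 0)) : s = t := by
  have h1 := h (mem_Ici.2 zero_le_one)
  rw [IsSpeed.halfFlow_of_pos one_pos, IsSpeed.halfFlow_of_pos one_pos] at h1
  have h2 := congrArg (clock v) (neg_injective (Real.exp_injective h1))
  rw [hv.toIsSpeed.clock_flow, hv.toIsSpeed.clock_flow] at h2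
  exact add_left_cancel h2

lemma halfFlow_ne_self (hv : IsFadingSpeed v) {t x : ℝ} (ht : t ≠ 0) (hx : 0 < x) :
    halfFlow v t x ≠ x := by
  rw [IsSpeed.halfFlow_of_pos hx]
  intro h
  nth_rewrite 2 [← Real.exp_log hx] at h
  have h1 : flow v t (-Real.log x) = -Real.log x := by
    linarith [Real.exp_injective h]
  have h2 := congrArg (clock v) h1
  rw [hv.toIsSpeed.clock_flow] at h2
  exact ht (by linarith)

/-- Szekeres' vector field of a contraction has the whole `C¹` centralizer as its flow. -/
lemma exists_eqOn_halfFlow (hv : IsFadingSpeed v) {g : ℝ → ℝ} (hg : CrHalfLineDiffeo 1 g)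
    (hc : ∀ x ∈ Ici (0 : ℝ), g (halfFlow v 1 x) = halfFlow v 1 (g x)) :
    ∃ t, EqOn g (halfFlow v t) (Ici 0) := by
  have hs := hv.toIsSpeed
  obtain ⟨⟨hg0, hbij, hgd, -⟩, hgC⟩ := hg
  have hgpos : ∀ y, 0 < g (Real.exp (-y)) := fun y =>
    lt_of_le_of_ne (hbij.mapsTo (Real.exp_pos _).le) fun h => (Real.exp_pos (-y)).ne'
      (hbij.injOn (Real.exp_pos _).le self_mem_Ici (by rw [hg0, ← h]))
  set g' := derivWithin g (Ici 0) with hg'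
  have hg'c : ContinuousOn g' (Ici 0) :=
    hgC.continuousOn_derivWithin (uniqueDiffOn_Ici 0) le_rfl
  have hgd' : ∀ x ∈ Ici (0 : ℝ), 0 < g' x ∧ HasDerivWithinAt g (g' x) (Ici 0) x := by
    intro x hx
    obtain ⟨d, hd0, hd⟩ := hgd x hx
    rw [hg', hd.derivWithin (uniqueDiffOn_Ici 0 x hx)]
    exact ⟨hd0, hd⟩
  have hda : ∀ y, HasDerivAt g (g' (Real.exp (-y))) (Real.exp (-y)) := fun y =>
    (hgd' _ (Real.exp_pos _).le).2.hasDerivAt (Ici_mem_nhds (Real.exp_pos _))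
  set h : ℝ → ℝ := fun y => -Real.log (g (Real.exp (-y))) with hh
  have hexp : ∀ y, Real.exp (-h y) = g (Real.exp (-y)) := fun y => by
    rw [hh, neg_neg, Real.exp_log (hgpos y)]
  set h' : ℝ → ℝ := fun y => g' (Real.exp (-y)) * (g (Real.exp (-y)) / Real.exp (-y))⁻¹ with hh'
  have hhd : ∀ y, HasDerivAt h (h' y) y := by
    intro y
    have h1 := (((hda y).comp y (hasDerivAt_neg y).exp).log (hgpos y).ne').neg
    refine h1.congr_deriv ?_
    simp only [hh', Function.comp]
    field_simp [(hgpos y).ne']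
  have hexp0 : Tendsto (fun y : ℝ => Real.exp (-y)) atTop (𝓝[>] 0) :=
    tendsto_nhdsWithin_iff.2 ⟨Real.tendsto_exp_neg_atTop_nhds_zero,
      Eventually.of_forall fun y => Real.exp_pos _⟩
  have hh'1 : Tendsto h' atTop (𝓝 1) := by
    have h0 := hgd' 0 self_mem_Ici
    have e1 : Tendsto (fun y => g' (Real.exp (-y))) atTop (𝓝 (g' 0)) :=
      ((hg'c 0 self_mem_Ici).mono Ioi_subset_Ici_self).tendsto.comp hexp0
    have e2 : Tendsto (fun y => g (Real.exp (-y)) / Real.exp (-y)) atTop (𝓝 (g' 0)) := by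
      have := (hasDerivWithinAt_iff_tendsto_slope' self_notMem_Ioi).1 h0.2.Ioi_of_Ici
      refine (this.comp hexp0).congr fun y => ?_
      simp [slope_def_field, hg0]
    simpa only [mul_inv_cancel₀ h0.1.ne'] using e1.mul (e2.inv₀ h0.1.ne')
  have hcomm : ∀ y, h (flow v 1 y) = flow v 1 (h y) := by
    intro y
    have := hc _ (Real.exp_pos (-y)).le
    rw [IsSpeed.halfFlow_exp, ← hexp, ← hexp, IsSpeed.halfFlow_exp] at this
    exact neg_injective (Real.exp_injective this)
  set H : ℝ → ℝ := fun s => clock v (h (unclock v s)) with hH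
  have hHd : ∀ s, HasDerivAt H
      ((v (h (unclock v s)))⁻¹ * (h' (unclock v s) * v (unclock v s))) s := fun s =>
    (hs.hasDerivAt_clock _).comp s ((hhd _).comp s (hs.hasDerivAt_unclock s))
  have hHp : ∀ s, H (s + 1) = H s + 1 := by
    intro s
    have : unclock v (s + 1) = flow v 1 (unclock v s) := by rw [flow, hs.clock_unclock]
    rw [hH]
    simp only
    rw [this, hcomm, hs.clock_flow]
  have hHcont : Continuous H := continuous_iff_continuousAt.2 fun s => (hHd s).continuousAt
  have hper : Function.Periodic (fun s => H s - s) 1 := fun s => by simp only [hHp]; ring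
  obtain ⟨K, hK⟩ : ∃ K, ∀ s, |H s - s| ≤ K := by
    obtain ⟨K, hK⟩ := isCompact_Icc.exists_bound_of_continuousOn (s := Icc (0 : ℝ) 1)
      (hHcont.sub continuous_id).continuousOn
    refine ⟨K, fun s => ?_⟩
    obtain ⟨z, hz, hzs⟩ := hper.exists_mem_Ico₀ one_pos s
    rw [show H s - s = H z - z from hzs]
    exact hK z (Ico_subset_Icc_self hz)
  have hlim : Tendsto (deriv H) atTop (𝓝 1) := by
    have e1 := hv.tendsto_div (h := h) (K := K) fun y => by
      simpa [hH, hs.unclock_clock] using hK (clock v y)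
    have e2 := ((e1.inv₀ one_ne_zero).mul hh'1).comp hs.tendsto_unclock
    rw [inv_one, one_mul] at e2
    refine e2.congr fun s => ?_
    rw [(hHd s).deriv]
    simp only [Function.comp]
    field_simp [hs.ne_zero]
  have hH1 : ∀ s, deriv H s = 1 := by
    refine eq_of_tendsto_of_periodic hlim fun s => ?_
    rw [← deriv_comp_add_const, funext hHp]
    exact deriv_add_const 1
  have hconst : ∀ s, H s = H 0 + s := by
    intro s
    have := is_const_of_deriv_eq_zero (f := fun s => H s - s)
      (fun s => ((hHd s).sub (hasDerivAt_id s)).differentiableAt)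
      (fun s => by
        refine (((hHd s).differentiableAt.hasDerivAt).sub (hasDerivAt_id s)).deriv.trans ?_
        rw [hH1, sub_self]) s 0
    linarith
  refine ⟨H 0, fun x hx => ?_⟩
  rcases (mem_Ici.1 hx).eq_or_lt with rfl | hx
  · rw [hg0, IsSpeed.halfFlow_of_nonpos le_rfl]
  · obtain ⟨y, rfl⟩ : ∃ y, Real.exp (-y) = x := ⟨-Real.log x, by rw [neg_neg, Real.exp_log hx]⟩
    rw [IsSpeed.halfFlow_exp, ← hexp]
    congr 2
    refine (hs.flow_eq ?_).symm
    have := hconst (clock v y)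
    simp only [hH, hs.unclock_clock] at this ⊢
    linarith

lemma centralizer_eq (hv : IsFadingSpeed v) {r : ℕ∞} (hr : 1 ≤ r) :
    Centralizer r (halfFlow v 1) = {g | ∃ t, CrHalfLineDiffeo r (halfFlow v t) ∧
      EqOn g (halfFlow v t) (Ici 0)} := by
  ext g
  constructor
  · rintro ⟨hg, hc⟩
    obtain ⟨t, ht⟩ := hv.exists_eqOn_halfFlow ⟨hg.1, hg.2.of_le (by exact_mod_cast hr)⟩ hc
    exact ⟨t, hg.congr ht.symm, ht⟩
  · rintro ⟨t, ht, hgt⟩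
    refine ⟨ht.congr hgt, fun x hx => ?_⟩
    rw [hgt (IsSpeed.mapsTo_halfFlow 1 hx), hgt hx, ← hv.toIsSpeed.halfFlow_add,
      ← hv.toIsSpeed.halfFlow_add, add_comm]

lemma centralizer_one_eq (hv : IsFadingSpeed v) :
    Centralizer 1 (halfFlow v 1) = {g | ∃ t, EqOn g (halfFlow v t) (Ici 0)} := by
  rw [hv.centralizer_eq le_rfl]
  ext g
  exact exists_congr fun t => and_iff_right
    ⟨hv.halfLineDiffeo t, (hv.contDiff_halfFlow t).contDiffOn⟩

end IsFadingSpeed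

lemma DecaysTo.exp_sub_one {ι : Type*} {n m : ℕ} {f : ι → ℝ → ℝ} (hf : DecaysTo n (m + 1) f)
    (hs : ∀ i, ContDiff ℝ ∞ (f i)) : DecaysTo n m (fun i y => Real.exp (f i y) - 1) := by
  have base : ∃ C Y : ℝ, ∀ i, ∀ y ≥ Y, |Real.exp (f i y) - 1| ≤ C * Real.exp (-(m * y)) := by
    obtain ⟨C, Y, hC⟩ := hf 0 (Nat.zero_le _)
    simp only [iteratedDeriv_zero] at hC
    obtain ⟨Z, hZ⟩ : ∃ Z : ℝ, ∀ y ≥ Z, |C| * Real.exp (-y) ≤ 1 := by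
      have := Real.tendsto_exp_neg_atTop_nhds_zero.const_mul |C|
      rw [mul_zero] at this
      exact eventually_atTop.1 (this.eventually_le_const one_pos)
    refine ⟨2 * |C|, max (max Y Z) 0, fun i y hy => ?_⟩
    obtain ⟨⟨hY, hZ'⟩, hy0⟩ : (Y ≤ y ∧ Z ≤ y) ∧ 0 ≤ y := by simpa using hy
    have h1 : |f i y| ≤ |C| * Real.exp (-((m + 1 : ℕ) * y)) :=
      (hC i y hY).trans (by gcongr; exact le_abs_self C)
    have h2 : Real.exp (-((m + 1 : ℕ) * y)) ≤ Real.exp (-y) := by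
      rw [Real.exp_le_exp]
      push_cast
      nlinarith [mul_nonneg (Nat.cast_nonneg (α := ℝ) m) hy0]
    have h3 : Real.exp (-((m + 1 : ℕ) * y)) ≤ Real.exp (-(m * y)) := by
      rw [Real.exp_le_exp]
      push_cast
      linarith
    have h4 : |f i y| ≤ 1 := h1.trans ((by gcongr : _ ≤ |C| * Real.exp (-y)).trans (hZ y hZ'))
    calc |Real.exp (f i y) - 1| ≤ 2 * |f i y| := Real.abs_exp_sub_one_le h4
      _ ≤ 2 * (|C| * Real.exp (-(m * y))) := by gcongr; exact h1.trans (by gcongr)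
      _ = _ := by ring
  rcases n with _ | n
  · exact DecaysTo.zero_iff.2 base
  · refine DecaysTo.succ_iff.2 ⟨base, ?_⟩
    have hm : DecaysTo (n + 1) 0 f := hf.mono le_rfl (Nat.zero_le _)
    have key := ((hm.mono n.le_succ le_rfl).exp hs).mul
      (DecaysTo.succ_iff.1 (hf.mono le_rfl m.le_succ)).2
      (fun i => (hs i).exp) (fun i => DecaysTo.deriv_smooth (hs i))
    rw [zero_add] at key
    convert key using 3 with i y
    rw [deriv_sub_const]
    exact _root_.deriv_exp ((hs i).differentiable (by simp) _)

lemma IsFadingSpeed.crHalfLineDiffeo {v : ℝ → ℝ} (hv : IsFadingSpeed v) {t : ℝ}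
    (hd : ∀ n m, DecaysTo n m (fun (_ : Unit) y => flow v t y - y)) (r : ℕ∞) :
    CrHalfLineDiffeo r (halfFlow v t) := by
  suffices h : ContDiff ℝ ∞ (halfFlow v t) from
    ⟨hv.halfLineDiffeo t, (h.of_le (by exact_mod_cast le_top)).contDiffOn⟩
  have hs : ContDiff ℝ ∞ (fun y => y - flow v t y) :=
    contDiff_id.sub (hv.toIsSpeed.contDiff_flow t)
  have key := contDiff_germ_zero (G := fun y => Real.exp (y - flow v t y) - 1)
    (hs.exp.sub contDiff_const)
    (fun n m => DecaysTo.exp_sub_one (f := fun (_ : Unit) y => y - flow v t y)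
      (by simpa only [neg_sub] using (hd n (m + 1)).neg) (fun _ => hs))
  convert contDiff_id.add key using 1
  ext x
  simp only [halfFlow, germ, id]
  split_ifs <;> ring

lemma IsFadingSpeed.exists_lipschitz {v : ℝ → ℝ} (hv : IsFadingSpeed v) {t : ℝ} {r : ℕ∞}
    (hr : 2 ≤ r) (h : CrHalfLineDiffeo r (halfFlow v t)) :
    ∃ K, ∀ x ∈ Icc (0 : ℝ) 1, ∀ z ∈ Icc (0 : ℝ) 1,
      |deriv (halfFlow v t) z - deriv (halfFlow v t) x| ≤ K * |z - x| := by
  have h2 : ContDiffOn ℝ (1 + 1) (halfFlow v t) (Icc 0 1) :=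
    (h.2.of_le (by
      rw [one_add_one_eq_two, show (2 : WithTop ℕ∞) = ((2 : ℕ∞) : WithTop ℕ∞) from rfl]
      exact_mod_cast hr)).mono Icc_subset_Ici_self
  have hu := uniqueDiffOn_Icc (zero_lt_one (α := ℝ))
  have h3 := ((contDiffOn_succ_iff_derivWithin hu).1 h2).2.2.congr
    (f₁ := deriv (halfFlow v t)) fun x hx =>
      ((hv.hasDerivAt_halfFlow t x).hasDerivWithinAt.derivWithin (hu x hx)).symm
  obtain ⟨K, hK⟩ := isCompact_Icc.exists_bound_of_continuousOn
    (h3.continuousOn_derivWithin hu le_rfl)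
  exact ⟨K, fun x hx z hz => (convex_Icc (0 : ℝ) 1).norm_image_sub_le_of_norm_derivWithin_le
    (h3.differentiableOn (by simp)) hK hx hz⟩

/-- A smooth `1`-periodic function equal to `1` at distance at most `ρ` and to `0` at distance
at least `σ` from the half-integers. -/
noncomputable def bump (ρ σ y : ℝ) : ℝ :=
  Real.smoothTransition ((-Real.cos (2 * Real.pi * y) - Real.cos (2 * Real.pi * σ)) /
    (Real.cos (2 * Real.pi * ρ) - Real.cos (2 * Real.pi * σ)))

section Bump

variable {ρ σ y : ℝ}

lemma contDiff_bump : ContDiff ℝ ∞ (bump ρ σ) :=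
  Real.smoothTransition.contDiff.comp
    (((Real.contDiff_cos.comp (contDiff_const.mul contDiff_id)).neg.sub contDiff_const).div_const _)

lemma bump_nonneg : 0 ≤ bump ρ σ y := Real.smoothTransition.nonneg _

lemma bump_le_one : bump ρ σ y ≤ 1 := Real.smoothTransition.le_one _

lemma periodic_bump : Function.Periodic (bump ρ σ) 1 := fun y => by
  rw [bump, bump, mul_add, mul_one, Real.cos_add_two_pi]

lemma neg_cos_two_pi_mul (N : ℕ) (y : ℝ) :
    -Real.cos (2 * Real.pi * y) = Real.cos (2 * Real.pi * |y - (N + 1 / 2)|) := by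
  rw [← Real.cos_abs (2 * Real.pi * |y - (N + 1 / 2)|), abs_mul, abs_abs, ← abs_mul, Real.cos_abs,
    show 2 * Real.pi * (y - (N + 1 / 2)) = 2 * Real.pi * y - Real.pi - N * (2 * Real.pi) by ring,
    Real.cos_sub_nat_mul_two_pi, Real.cos_sub_pi]

lemma cos_two_pi_mul_le {r s : ℝ} (hr : 0 ≤ r) (hrs : r ≤ s) (hs : s ≤ 1 / 2) :
    Real.cos (2 * Real.pi * s) ≤ Real.cos (2 * Real.pi * r) :=
  Real.cos_le_cos_of_nonneg_of_le_pi (by positivity) (by nlinarith [Real.pi_pos])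
    (by gcongr)

lemma cos_two_pi_mul_lt {r s : ℝ} (hr : 0 ≤ r) (hrs : r < s) (hs : s ≤ 1 / 2) :
    Real.cos (2 * Real.pi * s) < Real.cos (2 * Real.pi * r) :=
  Real.cos_lt_cos_of_nonneg_of_le_pi (by positivity) (by nlinarith [Real.pi_pos])
    (by gcongr)

lemma bump_eq_one (hρ : 0 ≤ ρ) (hρσ : ρ < σ) (hσ : σ ≤ 1 / 2) (N : ℕ)
    (hy : |y - (N + 1 / 2)| ≤ ρ) : bump ρ σ y = 1 := by
  refine Real.smoothTransition.one_of_one_le ?_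
  rw [one_le_div (sub_pos.2 (cos_two_pi_mul_lt hρ hρσ hσ)), neg_cos_two_pi_mul N]
  exact sub_le_sub_right (cos_two_pi_mul_le (abs_nonneg _) hy (hρσ.le.trans hσ)) _

lemma bump_eq_zero (hρ : 0 ≤ ρ) (hρσ : ρ < σ) (hσ : σ ≤ 1 / 2) (N : ℕ)
    (hy : σ ≤ |y - (N + 1 / 2)|) (hy' : |y - (N + 1 / 2)| ≤ 1 / 2) : bump ρ σ y = 0 := by
  refine Real.smoothTransition.zero_of_nonpos (div_nonpos_of_nonpos_of_nonneg ?_ ?_)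
  · rw [neg_cos_two_pi_mul N]
    exact sub_nonpos.2 (cos_two_pi_mul_le (hρ.trans hρσ.le) hy hy')
  · exact (sub_pos.2 (cos_two_pi_mul_lt hρ hρσ hσ)).le

end Bump

lemma Function.Periodic.exists_abs_le {f : ℝ → ℝ} (hp : Function.Periodic f 1)
    (hf : Continuous f) : ∃ C, ∀ y, |f y| ≤ C := by
  obtain ⟨C, hC⟩ := isCompact_Icc.exists_bound_of_continuousOn (s := Icc (0 : ℝ) 1)
    hf.continuousOn
  refine ⟨C, fun y => ?_⟩
  obtain ⟨z, hz, hzy⟩ := hp.exists_mem_Ico₀ one_pos y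
  rw [hzy]
  exact hC z (Ico_subset_Icc_self hz)

lemma Function.Periodic.deriv {f : ℝ → ℝ} (hp : Function.Periodic f 1) :
    Function.Periodic (deriv f) 1 := fun y => by
  rw [← deriv_comp_add_const, funext hp]

lemma Function.Periodic.iteratedDeriv {f : ℝ → ℝ} (hp : Function.Periodic f 1) (k : ℕ) :
    Function.Periodic (iteratedDeriv k f) 1 := by
  induction k with
  | zero => simpa using hp
  | succ k ih => rw [iteratedDeriv_succ]; exact ih.deriv

lemma DecaysTo.of_periodic {f : ℝ → ℝ} (hf : ContDiff ℝ ∞ f) (hp : Function.Periodic f 1)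
    (n : ℕ) : DecaysTo n 0 (fun _ : Unit => f) := by
  intro k _
  obtain ⟨C, hC⟩ := (hp.iteratedDeriv k).exists_abs_le
    (hf.continuous_iteratedDeriv k (by exact_mod_cast le_top))
  exact ⟨C, 0, fun _ y _ => by simpa using hC y⟩

/-- A positive function decaying rapidly at `+∞` together with all its derivatives. -/
noncomputable def tail (y : ℝ) : ℝ := Real.exp (-Real.exp y)

lemma tail_pos (y : ℝ) : 0 < tail y := Real.exp_pos _

lemma tail_le_one (y : ℝ) : tail y ≤ 1 :=
  Real.exp_le_one_iff.2 (neg_nonpos.2 (Real.exp_pos y).le)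

lemma contDiff_tail : ContDiff ℝ ∞ tail := Real.contDiff_exp.neg.exp

lemma hasDerivAt_tail (y : ℝ) : HasDerivAt tail (-(Real.exp y * tail y)) y :=
  (Real.hasDerivAt_exp y).neg.exp.congr_deriv (by simp only [tail, Pi.neg_apply]; ring)

lemma abs_deriv_tail_le (y : ℝ) : |deriv tail y| ≤ 1 := by
  rw [(hasDerivAt_tail y).deriv, abs_neg, abs_of_pos (mul_pos (Real.exp_pos _) (tail_pos _)), tail,
    Real.exp_neg, ← div_eq_mul_inv, div_le_one (Real.exp_pos _)]
  linarith [Real.add_one_le_exp (Real.exp y)]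

lemma isSpeed_tail : IsSpeed tail := ⟨contDiff_tail, tail_pos, fun y => by linarith [tail_le_one y]⟩

lemma decaysTo_tail (n m : ℕ) : DecaysTo n m (fun _ : Unit => tail) := by
  have base : ∀ m : ℕ, ∃ C Y : ℝ, ∀ _ : Unit, ∀ y ≥ Y, |tail y| ≤ C * Real.exp (-(m * y)) := by
    intro m
    refine ⟨m.factorial, 0, fun _ y _ => ?_⟩
    rw [abs_of_pos (tail_pos y), tail, Real.exp_neg, Real.exp_neg, ← div_eq_mul_inv,
      le_div_iff₀ (Real.exp_pos _), inv_mul_le_iff₀ (Real.exp_pos _), Real.exp_nat_mul]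
    have := Real.pow_div_factorial_le_exp (Real.exp y) (Real.exp_pos y).le m
    rwa [div_le_iff₀ (by positivity)] at this
  induction n generalizing m with
  | zero => exact DecaysTo.zero_iff.2 (base m)
  | succ n ih =>
    refine DecaysTo.succ_iff.2 ⟨base m, ?_⟩
    rw [funext fun y => (hasDerivAt_tail y).deriv]
    exact ((ih (m + 1)).exp_mul fun _ => contDiff_tail).neg

/-- The cut-off function, supported around the half-integers, which marks where the unperturbed
speed is constant. -/
noncomputable def plateau : ℝ → ℝ := bump 0.05 0.08

/-- The cut-off function which marks where the speed is perturbed. -/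
noncomputable def outer : ℝ → ℝ := bump 0.2 0.3

/-- A variant of `outer` vanishing on the support of `plateau`. -/
noncomputable def annular (y : ℝ) : ℝ := outer y - bump 0.1 0.15 y

section Cutoff

lemma contDiff_plateau : ContDiff ℝ ∞ plateau := contDiff_bump

lemma contDiff_outer : ContDiff ℝ ∞ outer := contDiff_bump

lemma contDiff_annular : ContDiff ℝ ∞ annular := contDiff_bump.sub contDiff_bump

lemma periodic_plateau : Function.Periodic plateau 1 := periodic_bump

lemma periodic_outer : Function.Periodic outer 1 := periodic_bump

lemma periodic_annular : Function.Periodic annular 1 := periodic_bump.sub periodic_bump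

variable {N : ℕ} {y : ℝ}

lemma plateau_eq_one (hy : |y - (N + 1 / 2)| ≤ 0.05) : plateau y = 1 :=
  bump_eq_one (by norm_num) (by norm_num) (by norm_num) N hy

lemma plateau_eq_zero (hy : 0.08 ≤ |y - (N + 1 / 2)|) (hy' : |y - (N + 1 / 2)| ≤ 1 / 2) :
    plateau y = 0 :=
  bump_eq_zero (by norm_num) (by norm_num) (by norm_num) N hy hy'

lemma outer_eq_one (hy : |y - (N + 1 / 2)| ≤ 0.2) : outer y = 1 :=
  bump_eq_one (by norm_num) (by norm_num) (by norm_num) N hy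

lemma annular_eq_zero (hy : |y - (N + 1 / 2)| ≤ 0.1) : annular y = 0 := by
  rw [annular, outer_eq_one (hy.trans (by norm_num)),
    bump_eq_one (by norm_num) (by norm_num) (by norm_num) N hy, sub_self]

lemma annular_eq_outer (hy : 0.15 ≤ |y - (N + 1 / 2)|) (hy' : |y - (N + 1 / 2)| ≤ 1 / 2) :
    annular y = outer y := by
  rw [annular, bump_eq_zero (by norm_num) (by norm_num) (by norm_num) N hy hy', sub_zero]

end Cutoff

/-- A smooth periodic function with controlled derivatives of order at most two. -/
structure IsCutoff (L : ℝ) (X : ℝ → ℝ) : Prop where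
  smooth : ContDiff ℝ ∞ X
  abs_le_one : ∀ y, |X y| ≤ 1
  abs_deriv_le : ∀ y, |deriv X y| ≤ L
  abs_deriv_deriv_le : ∀ y, |deriv (deriv X) y| ≤ L

lemma exists_isCutoff {X : ℝ → ℝ} (hX : ContDiff ℝ ∞ X) (hp : Function.Periodic X 1)
    (h1 : ∀ y, |X y| ≤ 1) : ∃ L, ∀ L' ≥ L, IsCutoff L' X := by
  have hX' := DecaysTo.deriv_smooth hX
  obtain ⟨A, hA⟩ := hp.deriv.exists_abs_le hX'.continuous
  obtain ⟨B, hB⟩ := hp.deriv.deriv.exists_abs_le (DecaysTo.deriv_smooth hX').continuous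
  exact ⟨max A B, fun L hL => ⟨hX, h1, fun y => (hA y).trans ((le_max_left _ _).trans hL),
    fun y => (hB y).trans ((le_max_right _ _).trans hL)⟩⟩

lemma plateau_nonneg (y : ℝ) : 0 ≤ plateau y := bump_nonneg

lemma plateau_le_one (y : ℝ) : plateau y ≤ 1 := bump_le_one

lemma abs_plateau_le_one (y : ℝ) : |plateau y| ≤ 1 :=
  abs_le.2 ⟨neg_one_lt_zero.le.trans (plateau_nonneg y), plateau_le_one y⟩

lemma abs_outer_le_one (y : ℝ) : |outer y| ≤ 1 :=
  abs_le.2 ⟨neg_one_lt_zero.le.trans bump_nonneg, bump_le_one⟩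

lemma abs_annular_le_one (y : ℝ) : |annular y| ≤ 1 :=
  abs_sub_le_of_nonneg_of_le bump_nonneg bump_le_one bump_nonneg bump_le_one

lemma exists_isCutoff_bound :
    ∃ L : ℝ, 0 ≤ L ∧ IsCutoff L plateau ∧ IsCutoff L outer ∧ IsCutoff L annular := by
  obtain ⟨A, hA⟩ := exists_isCutoff contDiff_plateau periodic_plateau abs_plateau_le_one
  obtain ⟨B, hB⟩ := exists_isCutoff contDiff_outer periodic_outer abs_outer_le_one
  obtain ⟨C, hC⟩ := exists_isCutoff contDiff_annular periodic_annular abs_annular_le_one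
  exact ⟨max 0 (max A (max B C)), le_max_left _ _, hA _ (by simp), hB _ (by simp), hC _ (by simp)⟩

/-- The function `tail`, made constant equal to `a` around the half-integers. -/
noncomputable def base (a y : ℝ) : ℝ := tail y + plateau y * (a - tail y)

section Base

variable {a : ℝ}

lemma contDiff_base : ContDiff ℝ ∞ (base a) :=
  contDiff_tail.add (contDiff_plateau.mul (contDiff_const.sub contDiff_tail))

lemma base_pos (ha : 0 < a) (y : ℝ) : 0 < base a y := by
  have h0 := plateau_nonneg y
  have h1 := plateau_le_one y
  have : base a y = (1 - plateau y) * tail y + plateau y * a := by rw [base]; ring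
  rw [this]
  rcases h0.eq_or_lt with h | h
  · rw [← h]
    simpa using tail_pos y
  · exact add_pos_of_nonneg_of_pos (mul_nonneg (sub_nonneg.2 h1) (tail_pos y).le) (mul_pos h ha)

lemma base_le_one (ha : a ≤ 1) (y : ℝ) : base a y ≤ 1 := by
  have h0 := plateau_nonneg y
  have h1 := plateau_le_one y
  rw [base]
  nlinarith [tail_le_one y]

lemma isSpeed_base (ha : 0 < a) (ha' : a ≤ 1) : IsSpeed (base a) :=
  ⟨contDiff_base, base_pos ha, fun y => (base_le_one ha' y).trans one_le_two⟩

lemma base_of_plateau_eq_one {y : ℝ} (h : plateau y = 1) : base a y = a := by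
  rw [base, h]
  ring

lemma base_of_plateau_eq_zero {y : ℝ} (h : plateau y = 0) : base a y = tail y := by
  rw [base, h]
  ring

lemma abs_deriv_base_le {L : ℝ} (hL : IsCutoff L plateau) (ha : 0 < a) (ha' : a ≤ 1) (y : ℝ) :
    |deriv (base a) y| ≤ 1 + L := by
  have hd : deriv (base a) y =
      (1 - plateau y) * deriv tail y + deriv plateau y * (a - tail y) := by
    have h1 := (hasDerivAt_tail y).differentiableAt.hasDerivAt
    have h2 := (contDiff_plateau.differentiable (by simp) y).hasDerivAt
    refine (h1.add (h2.mul (h1.const_sub a))).deriv.trans ?_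
    ring
  rw [hd]
  refine (abs_add_le _ _).trans (add_le_add ?_ ?_)
  · rw [abs_mul]
    refine mul_le_one₀ (abs_le.2 ⟨?_, ?_⟩) (abs_nonneg _) (abs_deriv_tail_le y)
    · linarith [plateau_le_one y]
    · linarith [plateau_nonneg y]
  · rw [abs_mul]
    calc |deriv plateau y| * |a - tail y| ≤ L * 1 := by
          gcongr
          · exact (abs_nonneg _).trans (hL.abs_deriv_le y)
          · exact hL.abs_deriv_le y
          · exact abs_sub_le_of_nonneg_of_le ha.le ha' (tail_pos y).le (tail_le_one y)
      _ = L := mul_one L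

end Base

/-- The derivative of `X * sin (2 * π * q * φ)` along a vector field `b`, where `φ` is a time
function of `b`. -/
noncomputable def wave (X : ℝ → ℝ) (q : ℝ) (b φ : ℝ → ℝ) (y : ℝ) : ℝ :=
  b y * deriv X y * Real.sin (2 * Real.pi * q * φ y) +
    X y * (2 * Real.pi * q) * Real.cos (2 * Real.pi * q * φ y)

section Wave

variable {X b φ : ℝ → ℝ} {q L : ℝ}

lemma contDiff_wave (hX : ContDiff ℝ ∞ X) (hb : ContDiff ℝ ∞ b) (hφ : ContDiff ℝ ∞ φ) :
    ContDiff ℝ ∞ (wave X q b φ) := by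
  have h : ContDiff ℝ ∞ (fun y => 2 * Real.pi * q * φ y) := contDiff_const.mul hφ
  exact ((hb.mul (DecaysTo.deriv_smooth hX)).mul h.sin).add ((hX.mul contDiff_const).mul h.cos)

lemma wave_congr {X' b' φ' : ℝ → ℝ} {y : ℝ} (hX : X =ᶠ[𝓝 y] X') (hb : b =ᶠ[𝓝 y] b')
    (hφ : φ =ᶠ[𝓝 y] φ') : wave X q b φ =ᶠ[𝓝 y] wave X' q b' φ' := by
  filter_upwards [hX, hX.deriv, hb, hφ] with z h1 h2 h3 h4
  rw [wave, wave, h1, h2, h3, h4]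

lemma wave_add_const (hq : q ≠ 0) (α y : ℝ) : wave X q b (fun y => φ y + α) y =
    Real.cos (2 * Real.pi * q * α) * wave X q b φ y +
      Real.sin (2 * Real.pi * q * α) * wave X q b (fun y => φ y + 1 / (4 * q)) y := by
  have h4 : 2 * Real.pi * q * (φ y + 1 / (4 * q)) = 2 * Real.pi * q * φ y + Real.pi / 2 := by
    field_simp
    ring
  simp only [wave, h4, mul_add, Real.sin_add, Real.cos_add, Real.sin_pi_div_two,
    Real.cos_pi_div_two]
  ring

lemma abs_wave_le (hX : IsCutoff L X) (hq : 0 ≤ q) {y : ℝ} (hb : |b y| ≤ 1) :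
    |wave X q b φ y| ≤ L + 2 * Real.pi * q := by
  refine (abs_add_le _ _).trans (add_le_add ?_ ?_)
  · rw [abs_mul, abs_mul]
    have hL : 0 ≤ L := (abs_nonneg _).trans (hX.abs_deriv_le y)
    calc |b y| * |deriv X y| * |Real.sin _| ≤ 1 * L * 1 := by
          gcongr
          · exact hX.abs_deriv_le y
          · exact Real.abs_sin_le_one _
      _ = L := by ring
  · rw [abs_mul, abs_mul, abs_of_nonneg (show 0 ≤ 2 * Real.pi * q by positivity)]
    calc |X y| * (2 * Real.pi * q) * |Real.cos _| ≤ 1 * (2 * Real.pi * q) * 1 := by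
          gcongr
          · exact hX.abs_le_one y
          · exact Real.abs_cos_le_one _
      _ = _ := by ring

lemma abs_mul_deriv_wave_le (hX : IsCutoff L X) (hq : 1 ≤ q) (hL : 0 ≤ L) {y : ℝ}
    (hb : ContDiff ℝ ∞ b) (hb0 : 0 < b y) (hb1 : b y ≤ 1) (hb' : |deriv b y| ≤ 1 + L)
    (hφ : HasDerivAt φ (b y)⁻¹ y) :
    |b y * deriv (wave X q b φ) y| ≤ ((2 + L) * L + 4 * Real.pi * L + 4 * Real.pi ^ 2) * q ^ 2 := by
  set θ := 2 * Real.pi * q * φ y with hθ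
  have hd : b y * deriv (wave X q b φ) y =
      b y * (deriv b y * deriv X y + b y * deriv (deriv X) y) * Real.sin θ +
        b y * deriv X y * (4 * Real.pi * q) * Real.cos θ -
          X y * (4 * Real.pi ^ 2 * q ^ 2) * Real.sin θ := by
    have hX1 := (hX.smooth.differentiable (by simp) y).hasDerivAt
    have hX2 := ((DecaysTo.deriv_smooth hX.smooth).differentiable (by simp) y).hasDerivAt
    have hb1 := (hb.differentiable (by simp) y).hasDerivAt
    have hθ' := hφ.const_mul (2 * Real.pi * q)
    have h := ((hb1.mul hX2).mul hθ'.sin).add ((hX1.mul_const (2 * Real.pi * q)).mul hθ'.cos)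
    rw [show deriv (wave X q b φ) y = _ from h.deriv, ← hθ]
    simp only [Pi.mul_apply]
    field_simp
    ring
  have hq0 : 0 ≤ q := zero_le_one.trans hq
  have hs := Real.abs_sin_le_one θ
  have hc := Real.abs_cos_le_one θ
  have hX1 := hX.abs_deriv_le y
  have hX2 := hX.abs_deriv_deriv_le y
  have hX0 := hX.abs_le_one y
  have hb2 : |b y| ≤ 1 := by rwa [abs_of_pos hb0]
  have e1 : |b y * (deriv b y * deriv X y + b y * deriv (deriv X) y) * Real.sin θ| ≤
      (2 + L) * L := by
    rw [abs_mul, abs_mul]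
    have : |deriv b y * deriv X y + b y * deriv (deriv X) y| ≤ (2 + L) * L := by
      refine (abs_add_le _ _).trans ?_
      rw [abs_mul, abs_mul]
      calc |deriv b y| * |deriv X y| + |b y| * |deriv (deriv X) y| ≤ (1 + L) * L + 1 * L := by
            gcongr
        _ = _ := by ring
    calc _ ≤ 1 * ((2 + L) * L) * 1 := by gcongr
      _ = _ := by ring
  have e2 : |b y * deriv X y * (4 * Real.pi * q) * Real.cos θ| ≤ 4 * Real.pi * L * q := by
    rw [abs_mul, abs_mul, abs_mul, abs_of_nonneg (show 0 ≤ 4 * Real.pi * q by positivity)]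
    calc _ ≤ 1 * L * (4 * Real.pi * q) * 1 := by gcongr
      _ = _ := by ring
  have e3 : |X y * (4 * Real.pi ^ 2 * q ^ 2) * Real.sin θ| ≤ 4 * Real.pi ^ 2 * q ^ 2 := by
    rw [abs_mul, abs_mul, abs_of_nonneg (show 0 ≤ 4 * Real.pi ^ 2 * q ^ 2 by positivity)]
    calc _ ≤ 1 * (4 * Real.pi ^ 2 * q ^ 2) * 1 := by gcongr
      _ = _ := by ring
  rw [hd]
  have hqq : q ≤ q ^ 2 := by nlinarith
  calc _ ≤ (2 + L) * L + 4 * Real.pi * L * q + 4 * Real.pi ^ 2 * q ^ 2 :=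
        (abs_sub _ _).trans (add_le_add ((abs_add_le _ _).trans (add_le_add e1 e2)) e3)
    _ ≤ (2 + L) * L * q ^ 2 + 4 * Real.pi * L * q ^ 2 + 4 * Real.pi ^ 2 * q ^ 2 := by
        gcongr ?_ + 4 * Real.pi * L * ?_ + _
        exact le_mul_of_one_le_right (by positivity) (hq.trans hqq)
    _ = _ := by ring

end Wave

lemma exists_iteratedDeriv_bound {G : ℝ → ℝ} (hG : ContDiff ℝ ∞ G) (n : ℕ) {s : Set ℝ}
    (hs : IsCompact s) : ∃ M, 0 ≤ M ∧ ∀ k ≤ n, ∀ y ∈ s, |iteratedDeriv k G y| ≤ M := by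
  have h := fun k : ℕ => hs.exists_bound_of_continuousOn
    (hG.continuous_iteratedDeriv k (by exact_mod_cast le_top)).continuousOn
  choose M hM using h
  refine ⟨∑ k ∈ Finset.range (n + 1), |M k|, Finset.sum_nonneg fun _ _ => abs_nonneg _,
    fun k hk y hy => ((hM k y hy).trans (le_abs_self _)).trans ?_⟩
  exact Finset.single_le_sum (f := fun k => |M k|) (fun _ _ => abs_nonneg _)
    (Finset.mem_range.2 (Nat.lt_succ_of_le hk))

/-- The relative perturbation of the speed `base a` with cut-off `X` and frequency `q`. -/
noncomputable def pert (X : ℝ → ℝ) (q a y : ℝ) : ℝ := a * wave X q (base a) (clock (base a)) y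

/-- The perturbed speed. -/
noncomputable def cell (X : ℝ → ℝ) (q a y : ℝ) : ℝ := base a y / (1 + pert X q a y)

/-- The conditions on the size `a` of the perturbation of frequency `q` in the interval
`[N, N + 1]`. -/
structure Stage (N : ℕ) (q a : ℝ) : Prop where
  one_le : 1 ≤ q
  pos : 0 < a
  mul_le : q * a ≤ 0.01
  abs_pert_outer_le : ∀ y, |pert outer q a y| ≤ 1 / 2
  abs_pert_annular_le : ∀ y, |pert annular q a y| ≤ 1 / 2
  abs_mul_deriv_pert_le : ∀ y, |base a y * deriv (pert outer q a) y| ≤ Real.exp (-N)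
  plateau_le : ∀ k ≤ N, ∀ y ∈ Icc (N : ℝ) (N + 1),
    |iteratedDeriv k (fun y => a * plateau y) y| ≤ Real.exp (-(N * N))
  pert_le : ∀ k ≤ N, ∀ y ∈ Icc (N : ℝ) (N + 1),
    |iteratedDeriv k (pert annular q a) y| ≤ Real.exp (-(N * N))

lemma eventually_mul_le (C : ℝ) {ε : ℝ} (hε : 0 < ε) : ∀ᶠ a in 𝓝[>] (0 : ℝ), a * C ≤ ε := by
  have : Tendsto (fun a : ℝ => a * C) (𝓝 0) (𝓝 0) := by
    simpa using (continuous_mul_const C).tendsto 0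
  exact (this.mono_left nhdsWithin_le_nhds).eventually_le_const hε

lemma contDiff_pert {X : ℝ → ℝ} (hX : ContDiff ℝ ∞ X) (q : ℝ) {a : ℝ} (ha : 0 < a) (ha' : a ≤ 1) :
    ContDiff ℝ ∞ (pert X q a) :=
  contDiff_const.mul (contDiff_wave hX contDiff_base (isSpeed_base ha ha').contDiff_clock)

/-- In the `annular` region the perturbation is a combination of two functions which do not
depend on its size. -/
lemma exists_pert_annular_eventuallyEq {N : ℕ} {q a y : ℝ} (hq : 1 ≤ q) (ha : 0 < a) (ha' : a ≤ 1)
    (hy : y ∈ Icc (N : ℝ) (N + 1)) : ∃ A B : ℝ, |A| ≤ 1 ∧ |B| ≤ 1 ∧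
      pert annular q a =ᶠ[𝓝 y] fun z => a * (A * wave annular q tail (clock tail) z +
        B * wave annular q tail (fun z => clock tail z + 1 / (4 * q)) z) := by
  have hs := isSpeed_base ha ha'
  have key : ∀ {l r : ℝ}, y ∈ Ioo l r → (∀ z ∈ Ioo l r, plateau z = 0) → ∃ A B : ℝ,
      |A| ≤ 1 ∧ |B| ≤ 1 ∧
      pert annular q a =ᶠ[𝓝 y] fun z => a * (A * wave annular q tail (clock tail) z +
        B * wave annular q tail (fun z => clock tail z + 1 / (4 * q)) z) := by
    intro l r hy h
    set α := clock (base a) y - clock tail y with hα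
    refine ⟨Real.cos (2 * Real.pi * q * α), Real.sin (2 * Real.pi * q * α),
      Real.abs_cos_le_one _, Real.abs_sin_le_one _, ?_⟩
    have hb : base a =ᶠ[𝓝 y] tail := by
      filter_upwards [isOpen_Ioo.mem_nhds hy] with z hz
      exact base_of_plateau_eq_zero (h z hz)
    have hφ : clock (base a) =ᶠ[𝓝 y] fun z => clock tail z + α := by
      filter_upwards [isOpen_Ioo.mem_nhds hy] with z hz
      have := hs.clock_sub (ψ := clock tail) (fun z hz => by
        rw [base_of_plateau_eq_zero (h z hz)]
        exact isSpeed_tail.hasDerivAt_clock z) hy hz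
      rw [hα]
      linarith
    filter_upwards [wave_congr (q := q) (EventuallyEq.refl (𝓝 y) annular) hb hφ] with z hz
    rw [pert, hz, wave_add_const (zero_lt_one.trans_le hq).ne']
  rcases lt_or_ge y (N + 0.42) with h1 | h1
  · refine key (l := N - 0.42) (r := N + 0.42) ⟨by linarith [hy.1], h1⟩ fun z hz => ?_
    rcases lt_or_ge z N with h2 | h2
    · rw [← periodic_plateau z]
      refine plateau_eq_zero (N := N) ?_ ?_
      · rw [abs_of_nonneg] <;> linarith [hz.1]
      · rw [abs_of_nonneg] <;> linarith [hz.1]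
    · refine plateau_eq_zero (N := N) ?_ ?_
      · rw [abs_of_nonpos] <;> linarith [hz.2]
      · rw [abs_of_nonpos] <;> linarith [hz.2]
  rcases lt_or_ge ((N : ℝ) + 0.58) y with h2 | h2
  · refine key (l := N + 0.58) (r := N + 1.42) ⟨h2, by linarith [hy.2]⟩ fun z hz => ?_
    rcases lt_or_ge ((N : ℝ) + 1) z with h3 | h3
    · rw [← periodic_plateau.sub_eq z]
      refine plateau_eq_zero (N := N) ?_ ?_
      · rw [abs_of_nonpos] <;> linarith [hz.2]
      · rw [abs_of_nonpos] <;> linarith [hz.2]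
    · refine plateau_eq_zero (N := N) ?_ ?_
      · rw [abs_of_nonneg] <;> linarith [hz.1]
      · rw [abs_of_nonneg] <;> linarith [hz.1]
  · refine ⟨0, 0, by simp, by simp, ?_⟩
    have h0 : annular =ᶠ[𝓝 y] fun _ => 0 := by
      filter_upwards [isOpen_Ioo.mem_nhds (show y ∈ Ioo (N + 0.4 : ℝ) (N + 0.6) from
        ⟨by linarith, by linarith⟩)] with z hz
      exact annular_eq_zero (N := N) (abs_le.2 ⟨by linarith [hz.1], by linarith [hz.2]⟩)
    filter_upwards [wave_congr (q := q) h0 (EventuallyEq.refl (𝓝 y) (base a))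
      (EventuallyEq.refl (𝓝 y) (clock (base a)))] with z hz
    rw [pert, hz]
    simp [wave]

lemma exists_stage (N : ℕ) {q : ℝ} (hq : 1 ≤ q) : ∃ a, Stage N q a := by
  obtain ⟨L, hL, hplateau, houter, hannular⟩ := exists_isCutoff_bound
  have hq0 : 0 ≤ q := zero_le_one.trans hq
  set C := (2 + L) * L + 4 * Real.pi * L + 4 * Real.pi ^ 2 with hC
  have hexpN : 0 < Real.exp (-(N * N : ℝ)) := Real.exp_pos _
  obtain ⟨M₀, hM₀, hM₀'⟩ := exists_iteratedDeriv_bound contDiff_plateau N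
    (isCompact_Icc (a := (N : ℝ)) (b := N + 1))
  have hG₁ : ContDiff ℝ ∞ (wave annular q tail (clock tail)) :=
    contDiff_wave contDiff_annular contDiff_tail isSpeed_tail.contDiff_clock
  have hG₂ : ContDiff ℝ ∞ (wave annular q tail (fun z => clock tail z + 1 / (4 * q))) :=
    contDiff_wave contDiff_annular contDiff_tail (isSpeed_tail.contDiff_clock.add contDiff_const)
  obtain ⟨M₁, hM₁, hM₁'⟩ := exists_iteratedDeriv_bound hG₁ N
    (isCompact_Icc (a := (N : ℝ)) (b := N + 1))
  obtain ⟨M₂, hM₂, hM₂'⟩ := exists_iteratedDeriv_bound hG₂ N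
    (isCompact_Icc (a := (N : ℝ)) (b := N + 1))
  obtain ⟨a, ha0, ha1, haq, haw, haC, hap, haM⟩ :=
    ((eventually_mem_nhdsWithin (a := (0 : ℝ)) (s := Ioi 0)).and
      ((eventually_mul_le 1 one_pos).and
      ((eventually_mul_le q (by norm_num : (0 : ℝ) < 0.01)).and
      ((eventually_mul_le (L + 2 * Real.pi * q) (by norm_num : (0 : ℝ) < 1 / 2)).and
      ((eventually_mul_le (C * q ^ 2) (Real.exp_pos (-N))).and
      ((eventually_mul_le M₀ hexpN).and (eventually_mul_le (M₁ + M₂) hexpN))))))).exists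
  rw [mem_Ioi] at ha0
  rw [mul_one] at ha1
  have habs : |a| = a := abs_of_pos ha0
  have hbase : ∀ y, |base a y| ≤ 1 := fun y => by
    rw [abs_of_pos (base_pos ha0 y)]
    exact base_le_one ha1 y
  have hpert : ∀ {X}, IsCutoff L X → ∀ y, |pert X q a y| ≤ 1 / 2 := fun hX y => by
    rw [pert, abs_mul, habs]
    exact (mul_le_mul_of_nonneg_left (abs_wave_le hX hq0 (hbase y)) ha0.le).trans haw
  refine ⟨a, hq, ha0, by rwa [mul_comm], hpert houter, hpert hannular, fun y => ?_,
    fun k hk y hy => ?_, fun k hk y hy => ?_⟩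
  · have hs := isSpeed_base ha0 ha1
    have hd : deriv (pert outer q a) y =
        a * deriv (wave outer q (base a) (clock (base a))) y :=
      deriv_const_mul_field _
    rw [hd, mul_left_comm, abs_mul, habs]
    exact (mul_le_mul_of_nonneg_left (abs_mul_deriv_wave_le houter hq hL contDiff_base
      (base_pos ha0 y) (base_le_one ha1 y) (abs_deriv_base_le hplateau ha0 ha1 y)
      (hs.hasDerivAt_clock y)) ha0.le).trans haC
  · rw [iteratedDeriv_const_mul_field, abs_mul, habs]
    exact (mul_le_mul_of_nonneg_left (hM₀' k hk y hy) ha0.le).trans hap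
  · obtain ⟨A, B, hA, hB, hAB⟩ := exists_pert_annular_eventuallyEq hq ha0 ha1 hy
    have hk' : ((k : ℕ) : WithTop ℕ∞) ≤ ∞ := by exact_mod_cast le_top
    rw [hAB.iteratedDeriv_eq, iteratedDeriv_const_mul_field,
      iteratedDeriv_fun_add ((contDiff_const.mul hG₁).of_le hk').contDiffAt
        ((contDiff_const.mul hG₂).of_le hk').contDiffAt,
      iteratedDeriv_const_mul_field, iteratedDeriv_const_mul_field, abs_mul, habs]
    refine (mul_le_mul_of_nonneg_left ((abs_add_le _ _).trans (add_le_add ?_ ?_)) ha0.le).trans haM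
    · rw [abs_mul]
      exact (mul_le_of_le_one_left (abs_nonneg _) hA).trans (hM₁' k hk y hy)
    · rw [abs_mul]
      exact (mul_le_of_le_one_left (abs_nonneg _) hB).trans (hM₂' k hk y hy)

/-- The function given by `H N` on `[N, N + 1)`. -/
noncomputable def glue (H : ℕ → ℝ → ℝ) (y : ℝ) : ℝ := H ⌊y⌋₊ y

/-- Consecutive functions agree around the positive integers. -/
def Gluable (H : ℕ → ℝ → ℝ) : Prop :=
  ∀ (N : ℕ) (y : ℝ), |y - (N + 1)| < 0.2 → H N y = H (N + 1) y

namespace Gluable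

variable {H : ℕ → ℝ → ℝ} {N : ℕ} {y : ℝ}

lemma glue_eq (hH : Gluable H) (hy : y ∈ Ioo (N - 0.2 : ℝ) (N + 1.2)) : glue H y = H N y := by
  rcases lt_or_ge y N with h | h
  · cases N with
    | zero => rw [glue, Nat.floor_of_nonpos (by simpa using h.le)]
    | succ M =>
      push_cast at h hy
      have hf : ⌊y⌋₊ = M :=
        (Nat.floor_eq_iff (by linarith [hy.1, M.cast_nonneg (α := ℝ)])).2 ⟨by linarith [hy.1], h⟩
      rw [glue, hf, hH M y (abs_lt.2 ⟨by linarith [hy.1], by linarith⟩)]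
  have h0 : 0 ≤ y := N.cast_nonneg.trans h
  rcases lt_or_ge y ((N : ℝ) + 1) with h' | h'
  · rw [glue, (Nat.floor_eq_iff h0).2 ⟨h, h'⟩]
  · have hf : ⌊y⌋₊ = N + 1 :=
      (Nat.floor_eq_iff h0).2 ⟨by push_cast; exact h', by push_cast; linarith [hy.2]⟩
    rw [glue, hf, hH N y (abs_lt.2 ⟨by linarith, by linarith [hy.2]⟩)]

lemma eventuallyEq (hH : Gluable H) (hy : y ∈ Icc (N : ℝ) (N + 1)) : glue H =ᶠ[𝓝 y] H N := by
  filter_upwards [isOpen_Ioo.mem_nhds (show y ∈ Ioo (N - 0.2 : ℝ) (N + 1.2) from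
    ⟨by linarith [hy.1], by linarith [hy.2]⟩)] with z hz
  exact hH.glue_eq hz

lemma exists_eventuallyEq (hH : Gluable H) (y : ℝ) : ∃ N, glue H =ᶠ[𝓝 y] H N := by
  rcases lt_or_ge y 0 with h | h
  · refine ⟨0, ?_⟩
    filter_upwards [isOpen_Iio.mem_nhds h] with z hz
    rw [glue, Nat.floor_of_nonpos (le_of_lt hz)]
  · exact ⟨⌊y⌋₊, hH.eventuallyEq ⟨Nat.floor_le h, (Nat.lt_floor_add_one y).le⟩⟩

lemma contDiff (hH : Gluable H) (h : ∀ N, ContDiff ℝ ∞ (H N)) : ContDiff ℝ ∞ (glue H) :=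
  contDiff_iff_contDiffAt.2 fun y =>
    let ⟨N, hN⟩ := hH.exists_eventuallyEq y
    (h N).contDiffAt.congr_of_eventuallyEq hN

lemma isSpeed (hH : Gluable H) (h : ∀ N, IsSpeed (H N)) : IsSpeed (glue H) :=
  ⟨hH.contDiff fun N => (h N).smooth, fun y => (h _).pos y, fun y => (h _).le_two y⟩

/-- If a bound on `f` in terms of `N` in `[N, N + 1]` tends to zero fast then `f` decays fast. -/
lemma decaysTo (hH : Gluable H) (h : ∀ N : ℕ, ∀ k ≤ N, ∀ y ∈ Icc (N : ℝ) (N + 1),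
    |iteratedDeriv k (H N) y| ≤ Real.exp (-(N * N))) (n m : ℕ) :
    DecaysTo n m (fun _ : Unit => glue H) := by
  intro k hk
  refine ⟨Real.exp (m * m + m), n, fun _ y hy => ?_⟩
  have h0 : 0 ≤ y := n.cast_nonneg.trans hy
  have hN : y ∈ Icc (⌊y⌋₊ : ℝ) (⌊y⌋₊ + 1) := ⟨Nat.floor_le h0, (Nat.lt_floor_add_one y).le⟩
  rw [(hH.eventuallyEq hN).iteratedDeriv_eq, ← Real.exp_add]
  refine (h _ k (hk.trans (Nat.le_floor hy)) y hN).trans (Real.exp_le_exp.2 ?_)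
  have hm : (0 : ℝ) ≤ m := m.cast_nonneg
  nlinarith [mul_le_mul_of_nonneg_left hN.2 hm, sq_nonneg ((⌊y⌋₊ : ℝ) - m),
    mul_nonneg hm (Nat.cast_nonneg (α := ℝ) ⌊y⌋₊), sq_nonneg (⌊y⌋₊ : ℝ), sq_nonneg (m : ℝ)]

end Gluable

lemma bump_eq_zero_near {ρ σ y : ℝ} (hρ : 0 ≤ ρ) (hρσ : ρ < σ) (hσ : σ ≤ 0.3) (N : ℕ)
    (hy : |y - (N + 1)| < 0.2) : bump ρ σ y = 0 := by
  obtain ⟨h1, h2⟩ := abs_lt.1 hy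
  rcases le_total y (N + 1) with h | h
  · have hy' : |y - (N + 1 / 2)| = y - (N + 1 / 2) := abs_of_nonneg (by linarith)
    exact bump_eq_zero hρ hρσ (by linarith) N (by rw [hy']; linarith) (by rw [hy']; linarith)
  · have hy' : |y - ((N + 1 : ℕ) + 1 / 2)| = -(y - (N + 1 + 1 / 2)) := by
      push_cast
      exact abs_of_nonpos (by linarith)
    exact bump_eq_zero hρ hρσ (by linarith) (N + 1) (by rw [hy']; linarith) (by rw [hy']; linarith)

section Near

variable {N : ℕ} {y : ℝ}

lemma plateau_eq_zero_near (hy : |y - (N + 1)| < 0.2) : plateau y = 0 :=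
  bump_eq_zero_near (by norm_num) (by norm_num) (by norm_num) N hy

lemma outer_eq_zero_near (hy : |y - (N + 1)| < 0.2) : outer y = 0 :=
  bump_eq_zero_near (by norm_num) (by norm_num) (by norm_num) N hy

lemma annular_eq_zero_near (hy : |y - (N + 1)| < 0.2) : annular y = 0 := by
  rw [annular, outer_eq_zero_near hy,
    bump_eq_zero_near (by norm_num) (by norm_num) (by norm_num) N hy, sub_zero]

lemma base_near (hy : |y - (N + 1)| < 0.2) (a : ℝ) : base a y = tail y :=
  base_of_plateau_eq_zero (plateau_eq_zero_near hy)

lemma pert_near {X : ℝ → ℝ} (hy : |y - (N + 1)| < 0.2)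
    (hX : ∀ z : ℝ, |z - (N + 1)| < 0.2 → X z = 0) (q a : ℝ) :
    pert X q a y = 0 := by
  have hX' : X =ᶠ[𝓝 y] fun _ => 0 := by
    have : IsOpen {z : ℝ | |z - (N + 1)| < 0.2} :=
      isOpen_lt (continuous_id.sub continuous_const).abs continuous_const
    filter_upwards [this.mem_nhds hy] with z hz using hX z hz
  rw [pert, wave, hX'.deriv_eq, hX'.eq_of_nhds]
  simp

lemma cell_near {X : ℝ → ℝ} (hy : |y - (N + 1)| < 0.2)
    (hX : ∀ z : ℝ, |z - (N + 1)| < 0.2 → X z = 0) (q a : ℝ) :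
    cell X q a y = tail y := by
  rw [cell, base_near hy, pert_near hy hX, add_zero, div_one]

end Near

namespace Stage

variable {N : ℕ} {q a : ℝ}

lemma le_one (h : Stage N q a) : a ≤ 1 := by
  nlinarith [h.one_le, h.pos, h.mul_le]

lemma isSpeed_base (h : Stage N q a) : IsSpeed (base a) := _root_.isSpeed_base h.pos h.le_one

lemma isSpeed_cell (h : Stage N q a) {X : ℝ → ℝ} (hX : ContDiff ℝ ∞ X)
    (h' : ∀ y, |pert X q a y| ≤ 1 / 2) : IsSpeed (cell X q a) := by
  have hp : ∀ y, 1 / 2 ≤ 1 + pert X q a y := fun y => by linarith [(abs_le.1 (h' y)).1]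
  have hb := base_pos h.pos
  refine ⟨h.isSpeed_base.smooth.div (contDiff_const.add (contDiff_pert hX q h.pos h.le_one))
    fun y => by linarith [hp y], fun y => div_pos (hb y) (by linarith [hp y]), fun y => ?_⟩
  rw [cell, div_le_iff₀ (by linarith [hp y])]
  linarith [hp y, base_le_one h.le_one y]

lemma isSpeed_cell_outer (h : Stage N q a) : IsSpeed (cell outer q a) :=
  h.isSpeed_cell contDiff_outer h.abs_pert_outer_le

lemma isSpeed_cell_annular (h : Stage N q a) : IsSpeed (cell annular q a) :=
  h.isSpeed_cell contDiff_annular h.abs_pert_annular_le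

end Stage

/-- The speed equal to `tail` where `outer` vanishes and to a small multiple of `cell outer q a`
where `outer` is equal to one. -/
noncomputable def slow (q a δ y : ℝ) : ℝ :=
  (1 - outer y) * tail y + δ * (outer y * cell outer q a y)

/-- Sequences of frequencies and amplitudes, with factors slowing down the resulting speeds. -/
structure Design (q a δ : ℕ → ℝ) : Prop where
  stage : ∀ N, Stage N (q N) (a N)
  pos : ∀ N, 0 < δ N
  le_one : ∀ N, δ N ≤ 1
  slow_le : ∀ N : ℕ, ∀ k ≤ N, ∀ y ∈ Icc (N : ℝ) (N + 1),
    |iteratedDeriv k (fun y => δ N * (outer y * cell outer (q N) (a N) y)) y| ≤ Real.exp (-(N * N))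

/-- The speed whose flow is studied. -/
noncomputable def speed (q a : ℕ → ℝ) : ℝ → ℝ := glue fun N => cell outer (q N) (a N)

/-- The unperturbed speed. -/
noncomputable def baseSpeed (a : ℕ → ℝ) : ℝ → ℝ := glue fun N => base (a N)

/-- The speed perturbed only where `baseSpeed` decays. -/
noncomputable def annularSpeed (q a : ℕ → ℝ) : ℝ → ℝ := glue fun N => cell annular (q N) (a N)

/-- The perturbed speed, slowed down around the half-integers. -/
noncomputable def slowSpeed (q a δ : ℕ → ℝ) : ℝ → ℝ := glue fun N => slow (q N) (a N) (δ N)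

lemma gluable_cell {X : ℝ → ℝ} (hX : ∀ (N : ℕ) (z : ℝ), |z - (N + 1)| < 0.2 → X z = 0)
    (q a : ℕ → ℝ) : Gluable fun N => cell X (q N) (a N) := fun N _ hy =>
  (cell_near hy (hX N) _ _).trans (cell_near hy (hX N) _ _).symm

lemma gluable_pert {X : ℝ → ℝ} (hX : ∀ (N : ℕ) (z : ℝ), |z - (N + 1)| < 0.2 → X z = 0)
    (q a : ℕ → ℝ) : Gluable fun N => pert X (q N) (a N) := fun N _ hy =>
  (pert_near hy (hX N) _ _).trans (pert_near hy (hX N) _ _).symm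

lemma gluable_base (a : ℕ → ℝ) : Gluable fun N => base (a N) := fun _ _ hy =>
  (base_near hy _).trans (base_near hy _).symm

lemma gluable_slow (q a δ : ℕ → ℝ) : Gluable fun N => slow (q N) (a N) (δ N) := fun N y hy => by
  simp only [slow, outer_eq_zero_near hy, zero_mul, mul_zero]

namespace Design

variable {q a δ : ℕ → ℝ}

lemma isSpeed_speed (h : Design q a δ) : IsSpeed (speed q a) :=
  (gluable_cell (fun _ _ => outer_eq_zero_near) q a).isSpeed fun N => (h.stage N).isSpeed_cell_outer

lemma isSpeed_baseSpeed (h : Design q a δ) : IsSpeed (baseSpeed a) :=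
  (gluable_base a).isSpeed fun N => (h.stage N).isSpeed_base

lemma isSpeed_annularSpeed (h : Design q a δ) : IsSpeed (annularSpeed q a) :=
  (gluable_cell (fun _ _ => annular_eq_zero_near) q a).isSpeed fun N =>
    (h.stage N).isSpeed_cell_annular

lemma isSpeed_slowSpeed (h : Design q a δ) : IsSpeed (slowSpeed q a δ) := by
  refine (gluable_slow q a δ).isSpeed fun N => ?_
  have hc := (h.stage N).isSpeed_cell_outer
  have h0 : ∀ y, 0 ≤ outer y := fun y => bump_nonneg
  have h1 : ∀ y, outer y ≤ 1 := fun y => bump_le_one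
  refine ⟨((contDiff_const.sub contDiff_outer).mul contDiff_tail).add
    (contDiff_const.mul (contDiff_outer.mul hc.smooth)), fun y => ?_, fun y => ?_⟩
  · rw [slow]
    rcases (h0 y).eq_or_lt with h2 | h2
    · rw [← h2]
      simpa using tail_pos y
    · exact add_pos_of_nonneg_of_pos (mul_nonneg (sub_nonneg.2 (h1 y)) (tail_pos y).le)
        (mul_pos (h.pos N) (mul_pos h2 (hc.pos y)))
  · have e1 : (1 - outer y) * tail y ≤ (1 - outer y) * 2 :=
      mul_le_mul_of_nonneg_left ((tail_le_one y).trans one_le_two) (sub_nonneg.2 (h1 y))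
    have e2 : outer y * cell outer (q N) (a N) y ≤ outer y * 2 :=
      mul_le_mul_of_nonneg_left (hc.le_two y) (h0 y)
    have e3 := mul_le_of_le_one_left (mul_nonneg (h0 y) (hc.pos y).le) (h.le_one N)
    rw [slow]
    linarith

lemma decaysTo_baseSpeed (h : Design q a δ) (n m : ℕ) :
    DecaysTo n m (fun _ : Unit => baseSpeed a) := by
  have hg : Gluable fun N y => a N * plateau y := fun N y hy => by
    simp only [plateau_eq_zero_near hy, mul_zero]
  have hc : ContDiff ℝ ∞ (glue fun N y => a N * plateau y) :=
    hg.contDiff fun N => contDiff_const.mul contDiff_plateau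
  have hp : ContDiff ℝ ∞ (fun y => 1 - plateau y) := contDiff_const.sub contDiff_plateau
  have h1 := (decaysTo_tail n m).mul (DecaysTo.of_periodic hp
    (fun y => congrArg (1 - ·) (periodic_plateau y)) n) (fun _ => contDiff_tail) fun _ => hp
  rw [add_zero] at h1
  have h2 := h1.add (hg.decaysTo (fun N => (h.stage N).plateau_le) n m)
    (fun _ => contDiff_tail.mul hp) fun _ => hc
  convert h2 using 3 with _ y
  simp only [baseSpeed, glue, base]
  ring

lemma decaysTo_annularSpeed (h : Design q a δ) (n m : ℕ) :
    DecaysTo n m (fun _ : Unit => annularSpeed q a) := by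
  have hg := gluable_pert (fun _ _ => annular_eq_zero_near) q a
  have hc : ContDiff ℝ ∞ (glue fun N => pert annular (q N) (a N)) :=
    hg.contDiff fun N => contDiff_pert contDiff_annular _ (h.stage N).pos (h.stage N).le_one
  have hc' : ContDiff ℝ ∞ fun y => 1 + glue (fun N => pert annular (q N) (a N)) y :=
    contDiff_const.add hc
  have hpos : ∀ y, 1 / 2 ≤ 1 + glue (fun N => pert annular (q N) (a N)) y := fun y => by
    have := (abs_le.1 ((h.stage ⌊y⌋₊).abs_pert_annular_le y)).1
    rw [glue]
    linarith
  have h1 := ((DecaysTo.const 1 n).add (hg.decaysTo (fun N => (h.stage N).pert_le) n 0)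
    (fun _ => contDiff_const) fun _ => hc).inv (fun _ => hc') (by norm_num) fun _ => hpos
  exact (h.decaysTo_baseSpeed n m).mul h1 (fun _ => h.isSpeed_baseSpeed.smooth)
    fun _ => hc'.inv fun y => by linarith [hpos y]

lemma decaysTo_slowSpeed (h : Design q a δ) (n m : ℕ) :
    DecaysTo n m (fun _ : Unit => slowSpeed q a δ) := by
  have hg : Gluable fun N y => δ N * (outer y * cell outer (q N) (a N) y) := fun N y hy => by
    simp only [outer_eq_zero_near hy, zero_mul, mul_zero]
  have hc : ContDiff ℝ ∞ (glue fun N y => δ N * (outer y * cell outer (q N) (a N) y)) :=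
    hg.contDiff fun N =>
      contDiff_const.mul (contDiff_outer.mul (h.stage N).isSpeed_cell_outer.smooth)
  have hp : ContDiff ℝ ∞ (fun y => 1 - outer y) := contDiff_const.sub contDiff_outer
  have h1 := (DecaysTo.of_periodic hp (fun y => congrArg (1 - ·) (periodic_outer y)) n).mul
    (decaysTo_tail n m) (fun _ => hp) (fun _ => contDiff_tail)
  rw [zero_add] at h1
  exact h1.add (hg.decaysTo h.slow_le n m) (fun _ => hp.mul contDiff_tail) fun _ => hc

lemma isFadingSpeed (h : Design q a δ) : IsFadingSpeed (speed q a) := by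
  have hg := gluable_pert (fun _ _ => outer_eq_zero_near) q a
  set g := glue fun N => pert outer (q N) (a N) with hgdef
  have hgs : ContDiff ℝ ∞ g :=
    hg.contDiff fun N => contDiff_pert contDiff_outer _ (h.stage N).pos (h.stage N).le_one
  have hs := h.isSpeed_baseSpeed
  have hd := h.decaysTo_baseSpeed
  have hpos : ∀ y, 1 / 2 ≤ 1 + g y := fun y => by
    have := (abs_le.1 ((h.stage ⌊y⌋₊).abs_pert_outer_le y)).1
    rw [hgdef, glue]
    linarith
  have heq : speed q a = fun y => baseSpeed a y / (1 + g y) := rfl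
  have h0 : Tendsto (baseSpeed a) atTop (𝓝 0) := DecaysTo.tendsto_zero (hd 0 1)
  have h0' : Tendsto (deriv (baseSpeed a)) atTop (𝓝 0) :=
    DecaysTo.tendsto_zero (DecaysTo.succ_iff.1 (hd 1 1)).2
  refine ⟨h.isSpeed_speed, ?_, ?_⟩
  · refine squeeze_zero (fun y => (h.isSpeed_speed.pos y).le) (fun y => ?_)
      (by simpa using h0.const_mul 2)
    rw [heq]
    simp only
    rw [div_le_iff₀ (by linarith [hpos y])]
    nlinarith [hpos y, hs.pos y]
  · have hbound : ∀ y ≥ 0, |deriv (speed q a) y| ≤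
        2 * |deriv (baseSpeed a) y| + 4 * Real.exp (1 - y) := by
      intro y hy
      have hN : y ∈ Icc (⌊y⌋₊ : ℝ) (⌊y⌋₊ + 1) := ⟨Nat.floor_le hy, (Nat.lt_floor_add_one y).le⟩
      have h1 := (hs.smooth.differentiable (by simp) y).hasDerivAt
      have h2 := (hgs.differentiable (by simp) y).hasDerivAt
      have hne : 1 + g y ≠ 0 := by linarith [hpos y]
      have hder : deriv (speed q a) y = deriv (baseSpeed a) y / (1 + g y) -
          baseSpeed a y * deriv g y / (1 + g y) ^ 2 := by
        refine (h1.div (h2.const_add 1) hne).deriv.trans ?_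
        field_simp
      have hstage := (h.stage ⌊y⌋₊).abs_mul_deriv_pert_le y
      rw [← (hg.eventuallyEq hN).deriv_eq] at hstage
      have e2 : |baseSpeed a y * deriv g y| ≤ Real.exp (1 - y) :=
        hstage.trans (Real.exp_le_exp.2 (by linarith [hN.2]))
      have hp := hpos y
      rw [hder]
      refine (abs_sub _ _).trans (add_le_add ?_ ?_)
      · rw [abs_div, abs_of_pos (show 0 < 1 + g y by linarith), div_le_iff₀ (by linarith)]
        nlinarith [abs_nonneg (deriv (baseSpeed a) y)]
      · rw [abs_div, abs_of_pos (show 0 < (1 + g y) ^ 2 by positivity),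
          div_le_iff₀ (by positivity)]
        have : 1 ≤ 4 * (1 + g y) ^ 2 := by nlinarith
        nlinarith [Real.exp_pos (1 - y)]
    have hexp : Tendsto (fun y : ℝ => Real.exp (1 - y)) atTop (𝓝 0) :=
      Real.tendsto_exp_atBot.comp (tendsto_atBot_add_const_left _ 1 tendsto_neg_atTop_atBot)
    refine squeeze_zero_norm' (a := fun y => 2 * |deriv (baseSpeed a) y| + 4 * Real.exp (1 - y))
      ?_ (by simpa using (h0'.abs.const_mul 2).add (hexp.const_mul 4))
    filter_upwards [eventually_ge_atTop 0] with y hy using hbound y hy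

end Design

lemma DecaysTo.of_eventuallyEq {ι κ : Type*} {n m : ℕ} {f : ℝ → ℝ} {g : ι → ℝ → ℝ}
    {h : κ → ℝ → ℝ} (hg : DecaysTo n m g) (hh : DecaysTo n m h) {Y : ℝ}
    (hf : ∀ y ≥ Y, (∃ i, f =ᶠ[𝓝 y] g i) ∨ ∃ i, f =ᶠ[𝓝 y] h i) :
    DecaysTo n m (fun _ : Unit => f) := by
  intro k hk
  obtain ⟨C₁, Y₁, h₁⟩ := hg k hk
  obtain ⟨C₂, Y₂, h₂⟩ := hh k hk
  refine ⟨max C₁ C₂, max Y (max Y₁ Y₂), fun _ y hy => ?_⟩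
  simp only [ge_iff_le, max_le_iff] at hy
  obtain ⟨i, hi⟩ | ⟨i, hi⟩ := hf y hy.1
  · rw [hi.iteratedDeriv_eq]
    refine (h₁ i y hy.2.1).trans ?_
    gcongr
    exact le_max_left _ _
  · rw [hi.iteratedDeriv_eq]
    refine (h₂ i y hy.2.2).trans ?_
    gcongr
    exact le_max_right _ _

/-- Multiplying a speed by a constant amounts to rescaling time. -/
lemma flow_eventuallyEq_of_eqOn {v w : ℝ → ℝ} (hv : IsSpeed v) (hw : IsSpeed w) {A B c σ y : ℝ}
    (h : ∀ y ∈ Ioo A B, w y = c * v y) (hy : y ∈ Ioo A B)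
    (hσ : flow v σ y ∈ Ioo A B) : flow w (σ / c) =ᶠ[𝓝 y] flow v σ := by
  refine flow_eventuallyEq hv hw (fun x hx z hz hxz => ?_) hy hσ
  rw [hw.clock_sub (ψ := fun x => clock v x / c) (fun x hx => ?_) hx hz, ← hxz, sub_div]
  rw [h x hx, mul_comm, mul_inv, ← div_eq_mul_inv]
  exact (hv.hasDerivAt_clock x).div_const c

lemma annular_eq_outer_of_le {N : ℕ} {y : ℝ} (hy : 0.15 ≤ |y - (N + 1 / 2)|)
    (hy' : |y - (N + 1 / 2)| ≤ 0.7) : annular y = outer y := by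
  rcases le_or_gt |y - (N + 1 / 2)| (1 / 2) with h | h
  · exact annular_eq_outer hy h
  rcases le_or_gt 0 (y - (N + 1 / 2)) with h0 | h0
  · rw [abs_of_nonneg h0] at h hy'
    have e : |y - 1 - (N + 1 / 2)| = -(y - 1 - (N + 1 / 2)) := abs_of_nonpos (by linarith)
    rw [← periodic_annular.sub_eq, ← periodic_outer.sub_eq]
    exact annular_eq_outer (N := N) (by rw [e]; linarith) (by rw [e]; linarith)
  · rw [abs_of_neg h0] at h hy'
    have e : |y + 1 - (N + 1 / 2)| = y + 1 - (N + 1 / 2) := abs_of_nonneg (by linarith)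
    rw [← periodic_annular, ← periodic_outer]
    exact annular_eq_outer (N := N) (by rw [e]; linarith) (by rw [e]; linarith)

lemma cell_annular_eq_cell_outer {A B : ℝ} (h : ∀ z ∈ Ioo A B, annular z = outer z) (q a : ℝ)
    {y : ℝ} (hy : y ∈ Ioo A B) : cell annular q a y = cell outer q a y := by
  have hX : annular =ᶠ[𝓝 y] outer := by
    filter_upwards [isOpen_Ioo.mem_nhds hy] with z hz using h z hz
  rw [cell, cell, pert, pert,
    (wave_congr hX (EventuallyEq.refl _ _) (EventuallyEq.refl _ _)).eq_of_nhds]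

lemma mem_Ioo_half {N : ℕ} {y : ℝ} (hy : y ∈ Ioo (N + 0.3 : ℝ) (N + 0.7)) :
    |y - (N + 1 / 2)| ≤ 0.2 := abs_le.2 ⟨by linarith [hy.1], by linarith [hy.2]⟩

lemma cell_outer_eq {N : ℕ} {q a y : ℝ} (hy : y ∈ Ioo (N + 0.3 : ℝ) (N + 0.7)) :
    cell outer q a y =
      base a y / (1 + a * (2 * Real.pi * q * Real.cos (2 * Real.pi * q * clock (base a) y))) := by
  have hX : outer =ᶠ[𝓝 y] fun _ => 1 := by
    filter_upwards [isOpen_Ioo.mem_nhds hy] with z hz using outer_eq_one (mem_Ioo_half hz)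
  rw [cell, pert, wave, hX.deriv_eq, hX.eq_of_nhds]
  simp

/-- A time function of the perturbed speed, in the region where `outer` is equal to one. -/
noncomputable def phase (q a y : ℝ) : ℝ :=
  clock (base a) y + a * Real.sin (2 * Real.pi * q * clock (base a) y)

lemma Stage.hasDerivAt_phase {N : ℕ} {q a y : ℝ} (h : Stage N q a)
    (hy : y ∈ Ioo (N + 0.3 : ℝ) (N + 0.7)) :
    HasDerivAt (phase q a) (cell outer q a y)⁻¹ y := by
  have h1 := h.isSpeed_base.hasDerivAt_clock y
  refine (h1.add ((h1.const_mul (2 * Real.pi * q)).sin.const_mul a)).congr_deriv ?_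
  rw [cell_outer_eq hy, inv_div, add_div, one_div, div_eq_mul_inv]
  ring

lemma phase_sub_of_natCast {q a y z : ℝ} (hq : q ≠ 0) {p : ℕ}
    (h : clock (base a) z - clock (base a) y = p / q) : phase q a z - phase q a y = p / q := by
  have e : 2 * Real.pi * q * clock (base a) z =
      2 * Real.pi * q * clock (base a) y + p * (2 * Real.pi) := by
    rw [eq_add_of_sub_eq' h]
    field_simp
  rw [phase, phase, e, Real.sin_add_nat_mul_two_pi, ← h]
  ring

namespace Design

variable {q a δ : ℕ → ℝ} {N : ℕ}

lemma speed_eq {y : ℝ} (hy : y ∈ Ioo (N - 0.2 : ℝ) (N + 1.2)) :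
    speed q a y = cell outer (q N) (a N) y :=
  (gluable_cell (fun _ _ => outer_eq_zero_near) q a).glue_eq hy

lemma annularSpeed_eq {y : ℝ} (hy : y ∈ Ioo (N - 0.2 : ℝ) (N + 1.2)) :
    annularSpeed q a y = cell annular (q N) (a N) y :=
  (gluable_cell (fun _ _ => annular_eq_zero_near) q a).glue_eq hy

lemma clock_speed_sub (h : Design q a δ) {y z : ℝ} (hy : y ∈ Ioo (N + 0.3 : ℝ) (N + 0.7))
    (hz : z ∈ Ioo (N + 0.3 : ℝ) (N + 0.7)) : clock (speed q a) z - clock (speed q a) y =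
      phase (q N) (a N) z - phase (q N) (a N) y := by
  refine h.isSpeed_speed.clock_sub (fun x hx => ?_) hy hz
  rw [speed_eq (N := N) ⟨by linarith [hx.1], by linarith [hx.2]⟩]
  exact (h.stage N).hasDerivAt_phase hx

lemma annularSpeed_eq_speed {A B : ℝ} (hA : N - 0.2 ≤ A) (hB : B ≤ N + 1.2)
    (hAB : ∀ z ∈ Ioo A B, 0.15 ≤ |z - (N + 1 / 2)|) {y : ℝ} (hy : y ∈ Ioo A B) :
    annularSpeed q a y = 1 * speed q a y := by
  have hy' : y ∈ Ioo (N - 0.2 : ℝ) (N + 1.2) := ⟨hA.trans_lt hy.1, hy.2.trans_le hB⟩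
  rw [annularSpeed_eq hy', speed_eq hy', one_mul]
  refine cell_annular_eq_cell_outer (fun z hz => annular_eq_outer_of_le (hAB z hz) ?_) _ _ hy
  exact abs_le.2 ⟨by linarith [hz.1], by linarith [hz.2]⟩

lemma flow_annularSpeed_eventuallyEq (h : Design q a δ) {σ y : ℝ} (hy : y ∈ Icc (N : ℝ) (N + 1))
    (hy' : y ≤ N + 0.32 ∨ N + 0.68 ≤ y) (hσ : 0 ≤ σ) (hyσ : flow (speed q a) σ y ≤ y + 0.01) :
    flow (annularSpeed q a) σ =ᶠ[𝓝 y] flow (speed q a) σ := by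
  have hle := h.isSpeed_speed.le_flow hσ y
  have key : ∀ {A B : ℝ}, N - 0.2 ≤ A → B ≤ N + 1.2 →
      (∀ z ∈ Ioo A B, 0.15 ≤ |z - (N + 1 / 2)|) → A < y → y + 0.01 < B →
      flow (annularSpeed q a) σ =ᶠ[𝓝 y] flow (speed q a) σ := fun hA hB hAB h1 h2 => by
    simpa using flow_eventuallyEq_of_eqOn h.isSpeed_speed h.isSpeed_annularSpeed (σ := σ)
      (fun z hz => annularSpeed_eq_speed hA hB hAB hz)
      ⟨h1, by linarith⟩ ⟨h1.trans_le hle, hyσ.trans_lt h2⟩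
  rcases hy' with h' | h'
  · refine key (A := N - 0.2) (B := N + 0.35) le_rfl (by linarith) (fun z hz => ?_)
      (by linarith [hy.1]) (by linarith)
    rw [abs_of_nonpos] <;> linarith [hz.2]
  · refine key (A := N + 0.65) (B := N + 1.2) (by linarith) le_rfl (fun z hz => ?_)
      (by linarith) (by linarith [hy.2])
    rw [abs_of_nonneg] <;> linarith [hz.1]

lemma flow_slowSpeed_eventuallyEq (h : Design q a δ) {σ y : ℝ} (hσ : 0 ≤ σ)
    (hy : y ∈ Ioo (N + 0.3 : ℝ) (N + 0.7)) (hyσ : flow (speed q a) σ y < N + 0.7) :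
    flow (slowSpeed q a δ) (σ / δ N) =ᶠ[𝓝 y] flow (speed q a) σ := by
  refine flow_eventuallyEq_of_eqOn h.isSpeed_speed h.isSpeed_slowSpeed
    (fun z hz => ?_) hy ⟨hy.1.trans_le (h.isSpeed_speed.le_flow hσ y), hyσ⟩
  have hz' : z ∈ Ioo (N - 0.2 : ℝ) (N + 1.2) := ⟨by linarith [hz.1], by linarith [hz.2]⟩
  rw [speed_eq hz', slowSpeed, (gluable_slow q a δ).glue_eq hz', slow,
    outer_eq_one (mem_Ioo_half hz)]
  ring

lemma flow_speed_eventuallyEq (h : Design q a δ) (p : ℕ) {y : ℝ}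
    (hy : y ∈ Ioo (N + 0.3 : ℝ) (N + 0.7)) (hyp : flow (baseSpeed a) (p / q N) y < N + 0.7) :
    flow (speed q a) (p / q N) =ᶠ[𝓝 y] flow (baseSpeed a) (p / q N) := by
  have hq : 0 < q N := zero_lt_one.trans_le (h.stage N).one_le
  have hp : 0 ≤ p / q N := by positivity
  refine flow_eventuallyEq h.isSpeed_baseSpeed h.isSpeed_speed (fun x hx z hz hxz => ?_) hy
    ⟨hy.1.trans_le (h.isSpeed_baseSpeed.le_flow hp y), hyp⟩
  rw [h.clock_speed_sub hx hz]
  refine phase_sub_of_natCast hq.ne' ?_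
  rw [← hxz, ← h.isSpeed_baseSpeed.clock_sub (fun w hw => ?_) hx hz]
  rw [baseSpeed, (gluable_base a).glue_eq (N := N) ⟨by linarith [hw.1], by linarith [hw.2]⟩]
  exact (h.stage N).isSpeed_base.hasDerivAt_clock w

/-- The flow is smooth at the times which are well approximated by multiples of `1 / q N`. -/
theorem crHalfLineDiffeo (h : Design q a δ) {t : ℝ} (ht0 : 0 ≤ t) (ht2 : t ≤ 2)
    (ht : ∀ N, ∃ p : ℕ, 0 ≤ t - p / q N ∧ t - p / q N ≤ δ N) (r : ℕ∞) :
    CrHalfLineDiffeo r (halfFlow (speed q a) t) := by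
  refine h.isFadingSpeed.crHalfLineDiffeo (fun n m => ?_) r
  have hv := h.isSpeed_speed
  have hb := h.isSpeed_baseSpeed
  have hs := h.isSpeed_slowSpeed
  obtain ⟨Y₁, hY₁⟩ := eventually_atTop.1 (h.isFadingSpeed.tendsto.eventually_le_const
    (by norm_num : (0 : ℝ) < 0.005))
  obtain ⟨Y₂, hY₂⟩ := eventually_atTop.1 ((DecaysTo.tendsto_zero
    (h.decaysTo_baseSpeed 0 1)).eventually_le_const (by norm_num : (0 : ℝ) < 0.005))
  have ha := (h.isSpeed_annularSpeed.decaysTo_flow h.decaysTo_annularSpeed 2 n m).2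
  have hb' := (hb.decaysTo_flow h.decaysTo_baseSpeed 2 (n + 1) m).2
  have hs' := hs.decaysTo_flow h.decaysTo_slowSpeed 2 n m
  have hsub : ∀ {v}, IsSpeed v → ∀ τ, ContDiff ℝ ∞ fun y => flow v τ y - y := fun hv τ =>
    (hv.contDiff_flow τ).sub contDiff_id
  have hcomp := ((hb'.reindex Prod.fst).comp
    (Φ := fun i : Icc (-2 : ℝ) 2 × Icc (-2 : ℝ) 2 => flow (slowSpeed q a δ) i.2) (K := 4)
    (hs'.1.reindex Prod.snd) (fun i => hsub hb i.1) (fun i => hs.contDiff_flow i.2)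
    (fun i y => by
      have := abs_le.2 i.2.2
      linarith [hs.abs_flow_sub_le i.2 y])).mono n.le_succ le_rfl
  have hfam := hcomp.add (hs'.2.reindex Prod.snd)
    (fun i => (hsub hb i.1).comp (hs.contDiff_flow i.2)) fun i => hsub hs i.2
  refine DecaysTo.of_eventuallyEq ha hfam (Y := max 0 (max Y₁ Y₂)) fun y hy => ?_
  simp only [ge_iff_le, max_le_iff] at hy
  obtain ⟨hy0, hy1, hy2⟩ := hy
  have hN : y ∈ Icc (⌊y⌋₊ : ℝ) (⌊y⌋₊ + 1) := ⟨Nat.floor_le hy0, (Nat.lt_floor_add_one y).le⟩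
  set N := ⌊y⌋₊
  by_cases hyN : y ≤ N + 0.32 ∨ N + 0.68 ≤ y
  · left
    have hfl := hv.flow_le ht0 hY₁ hy1
    refine ⟨⟨t, by linarith, ht2⟩, ?_⟩
    filter_upwards [h.flow_annularSpeed_eventuallyEq hN hyN ht0 (by linarith)] with z hz
    rw [hz]
  · right
    rw [not_or, not_le, not_le] at hyN
    have hyI : y ∈ Ioo (N + 0.3 : ℝ) (N + 0.7) := ⟨by linarith, by linarith⟩
    obtain ⟨p, hp0, hp1⟩ := ht N
    set ρ := t - p / q N with hρ
    have hq : 0 < q N := zero_lt_one.trans_le (h.stage N).one_le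
    have hpq : 0 ≤ p / q N := by positivity
    have hρ1 : ρ ≤ 1 := hp1.trans (h.le_one N)
    have hle := hv.le_flow hp0 y
    have hfl := hv.flow_le hp0 hY₁ hy1
    have hflI : flow (speed q a) ρ y ∈ Ioo (N + 0.3 : ℝ) (N + 0.7) := ⟨by linarith, by linarith⟩
    have hfl' := hb.flow_le hpq hY₂ (hy2.trans hle)
    have h1 := h.flow_slowSpeed_eventuallyEq hp0 hyI hflI.2
    have h2 := h.flow_speed_eventuallyEq p hflI (by linarith)
    have h3 := (hv.contDiff_flow ρ).continuous.continuousAt.eventually h2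
    have hρδ : ρ / δ N ≤ 1 := (div_le_one (h.pos N)).2 hp1
    have hρδ' : 0 ≤ ρ / δ N := div_nonneg hp0 (h.pos N).le
    refine ⟨⟨⟨p / q N, by linarith, by linarith⟩, ⟨ρ / δ N, by linarith, by linarith⟩⟩, ?_⟩
    filter_upwards [h1, h3] with z hz1 hz3
    have ht' : t = p / q N + ρ := by rw [hρ]; ring
    rw [hz1, ht', hv.flow_add, hz3]
    ring

end Design

section Plateau

variable {N : ℕ} {y z : ℝ}

lemma base_eq_of_mem_Ioo {a : ℝ} (hy : y ∈ Ioo (N + 0.45 : ℝ) (N + 0.55)) : base a y = a :=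
  base_of_plateau_eq_one
    (plateau_eq_one (N := N) (abs_le.2 ⟨by linarith [hy.1], by linarith [hy.2]⟩))

lemma Stage.clock_base_sub {q a : ℝ} (h : Stage N q a) (hy : y ∈ Ioo (N + 0.45 : ℝ) (N + 0.55))
    (hz : z ∈ Ioo (N + 0.45 : ℝ) (N + 0.55)) :
    clock (base a) z - clock (base a) y = (z - y) / a := by
  rw [h.isSpeed_base.clock_sub (ψ := fun x => x / a) (fun x hx => ?_) hy hz, sub_div]
  rw [base_eq_of_mem_Ioo hx, inv_eq_one_div]
  exact (hasDerivAt_id x).div_const a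

lemma Design.speed_eq_of_mem_Ioo {q a : ℕ → ℝ} (hy : y ∈ Ioo (N + 0.45 : ℝ) (N + 0.55)) :
    speed q a y = a N / (1 + a N * (2 * Real.pi * q N *
      Real.cos (2 * Real.pi * q N * clock (base (a N)) y))) := by
  rw [speed_eq (N := N) ⟨by linarith [hy.1], by linarith [hy.2]⟩,
    cell_outer_eq (N := N) ⟨by linarith [hy.1], by linarith [hy.2]⟩, base_eq_of_mem_Ioo hy]

end Plateau

set_option maxHeartbeats 1000000 in
/-- If the fractional part of `q N * t` is close to `1 / 2` then the derivative of the time `t` of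
the flow has a large variation around `exp (-(N + 1 / 2))`. -/
lemma Design.exists_deriv_sub_ge {q a δ : ℕ → ℝ} (h : Design q a δ) {t : ℝ} (ht0 : 0 ≤ t)
    (ht1 : t ≤ 1) {N p : ℕ} (hsmall : ∀ x ≥ (N : ℝ), speed q a x ≤ 0.005)
    (hp : 1 / 2 ≤ q N * t - p) (hp' : q N * t - p ≤ 0.7) :
    ∃ x ∈ Icc (0 : ℝ) 1, ∃ z ∈ Icc (0 : ℝ) 1, |z - x| ≤ a N / (2 * q N) ∧ 0 < a N ∧
      q N * a N ≤ deriv (halfFlow (speed q a) t) z - deriv (halfFlow (speed q a) t) x := by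
  have hs := h.isSpeed_speed
  have hst := h.stage N
  have hq1 := hst.one_le
  have ha0 := hst.pos
  have hqa := hst.mul_le
  set Q := q N with hQ
  set A := a N with hA
  set φ := clock (base A) with hφ
  have hQ0 : 0 < Q := zero_lt_one.trans_le hq1
  have hA1 : A ≤ 0.01 := (le_mul_of_one_le_left ha0.le hq1).trans hqa
  have hAQ : A / Q ≤ 0.01 := (div_le_self ha0.le hq1).trans hA1
  have hAQ0 : 0 < A / Q := div_pos ha0 hQ0
  have hpi := Real.pi_gt_three
  have hpi' := Real.pi_lt_d2
  have hN0 : (0 : ℝ) ≤ N := N.cast_nonneg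
  set c := A * (2 * Real.pi * Q) with hc
  have hc0 : 0 < c := by positivity
  have hc6 : 6 * (Q * A) ≤ c := by rw [hc]; nlinarith [mul_pos hQ0 ha0]
  have hc7 : c ≤ 0.07 := by rw [hc]; nlinarith [mul_pos hQ0 ha0]
  -- `y₁` and `y₂` are consecutive points where the speed is minimal and maximal
  set J := ⌈Q * φ (N + 0.46)⌉ with hJ
  set y₁ := N + 0.46 + A * (J / Q - φ (N + 0.46)) with hy₁
  set y₂ := y₁ + A / Q / 2 with hy₂
  have hJ0 : 0 ≤ J / Q - φ (N + 0.46) := by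
    rw [sub_nonneg, le_div_iff₀ hQ0, mul_comm]
    exact Int.le_ceil _
  have hJ1 : A * (J / Q - φ (N + 0.46)) ≤ A / Q := by
    rw [div_eq_mul_one_div A Q]
    refine mul_le_mul_of_nonneg_left ?_ ha0.le
    rw [sub_le_iff_le_add, div_le_iff₀ hQ0, add_mul, one_div_mul_cancel hQ0.ne', mul_comm (φ _)]
    have : (J : ℝ) < Q * φ (N + 0.46) + 1 := Int.ceil_lt_add_one _
    linarith
  have hJ0' := mul_nonneg ha0.le hJ0
  have hm₁ : y₁ ∈ Ioo (N + 0.45 : ℝ) (N + 0.55) := ⟨by linarith, by linarith⟩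
  have hm₂ : y₂ ∈ Ioo (N + 0.45 : ℝ) (N + 0.55) := ⟨by linarith, by linarith⟩
  have hφ₁ : φ y₁ = J / Q := by
    have := hst.clock_base_sub (y := N + 0.46) (z := y₁) ⟨by linarith, by linarith⟩ hm₁
    rw [show y₁ - (N + 0.46) = A * (J / Q - φ (N + 0.46)) by rw [hy₁]; ring,
      mul_div_cancel_left₀ _ ha0.ne'] at this
    linarith
  have hφ₂ : φ y₂ = J / Q + 1 / (2 * Q) := by
    have := hst.clock_base_sub hm₁ hm₂
    rw [show y₂ - y₁ = A / Q / 2 by rw [hy₂]; ring] at this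
    have e : A / Q / 2 / A = 1 / (2 * Q) := by field_simp
    linarith
  have hθ₁ : 2 * Real.pi * Q * φ y₁ = J * (2 * Real.pi) := by
    rw [hφ₁]
    field_simp
  have hθ₂ : 2 * Real.pi * Q * φ y₂ = Real.pi + J * (2 * Real.pi) := by
    rw [hφ₂]
    field_simp
    ring
  have hv₁ : speed q a y₁ = A / (1 + c) := by
    rw [Design.speed_eq_of_mem_Ioo hm₁, ← hφ, hθ₁, Real.cos_int_mul_two_pi, mul_one]
  have hv₂ : speed q a y₂ = A / (1 - c) := by
    rw [Design.speed_eq_of_mem_Ioo hm₂, ← hφ, hθ₂, Real.cos_add_int_mul_two_pi, Real.cos_pi, hc]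
    ring
  -- their images under the flow
  have hz : ∀ y ∈ Icc y₁ y₂, flow (speed q a) t y ∈ Ioo (N + 0.45 : ℝ) (N + 0.55) := fun y hy => by
    have h1 := hs.le_flow ht0 y
    have h2 := hs.flow_le ht0 hsmall (y := y) (by linarith [hm₁.1, hy.1])
    exact ⟨by linarith [hm₁.1, hy.1], by linarith [hy.2]⟩
  set z₁ := flow (speed q a) t y₁ with hz₁
  set z₂ := flow (speed q a) t y₂ with hz₂
  have hy₁₂ : y₁ ≤ y₂ := by linarith
  have hn₁ : z₁ ∈ Ioo (N + 0.45 : ℝ) (N + 0.55) := hz y₁ ⟨le_rfl, hy₁₂⟩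
  have hn₂ : z₂ ∈ Ioo (N + 0.45 : ℝ) (N + 0.55) := hz y₂ ⟨hy₁₂, le_rfl⟩
  set s := Real.sin (2 * Real.pi * Q * φ z₁) with hs'
  have hs1 : -1 ≤ s := Real.neg_one_le_sin _
  have hsin : Real.sin (J * (2 * Real.pi)) = 0 := by
    simpa using Real.sin_add_int_mul_two_pi 0 J
  have hφz : φ z₁ = J / Q + t - A * s := by
    have h1 := h.clock_speed_sub (N := N) (y := y₁) (z := z₁)
      ⟨by linarith [hm₁.1], by linarith [hm₁.2]⟩ ⟨by linarith [hn₁.1], by linarith [hn₁.2]⟩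
    rw [hz₁, hs.clock_flow, ← hz₁, phase, phase, ← hφ, hθ₁, ← hs', hsin, hφ₁] at h1
    linarith
  have hcos : Real.cos (2 * Real.pi * Q * φ z₁) ≤ 0 := by
    have e : 2 * Real.pi * Q * φ z₁ =
        2 * Real.pi * (Q * t - p - Q * A * s) + ((J + p : ℤ) : ℝ) * (2 * Real.pi) := by
      rw [hφz]
      push_cast
      field_simp
      ring
    have hQAs : |Q * A * s| ≤ 0.01 := by
      rw [abs_mul, abs_of_pos (mul_pos hQ0 ha0)]
      exact (mul_le_of_le_one_right (mul_pos hQ0 ha0).le (Real.abs_sin_le_one _)).trans hqa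
    have hu := mul_le_mul_of_nonneg_left (show 1 / 4 ≤ Q * t - p - Q * A * s by
      linarith [(abs_le.1 hQAs).2]) Real.two_pi_pos.le
    have hu' := mul_le_mul_of_nonneg_left (show Q * t - p - Q * A * s ≤ 3 / 4 by
      linarith [(abs_le.1 hQAs).1]) Real.two_pi_pos.le
    rw [e, Real.cos_add_int_mul_two_pi]
    exact Real.cos_nonpos_of_pi_div_two_le_of_le (by linarith) (by linarith)
  have hvz₁ : A ≤ speed q a z₁ := by
    rw [Design.speed_eq_of_mem_Ioo hn₁, ← hφ, ← mul_assoc, ← hc]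
    have := Real.neg_one_le_cos (2 * Real.pi * Q * φ z₁)
    rw [le_div_iff₀ (by nlinarith)]
    nlinarith [mul_nonneg hc0.le (neg_nonneg.2 hcos)]
  have hvz₂ : speed q a z₂ ≤ A / (1 - c) := by
    rw [Design.speed_eq_of_mem_Ioo hn₂, ← hφ, ← mul_assoc, ← hc]
    have := Real.neg_one_le_cos (2 * Real.pi * Q * φ z₂)
    exact div_le_div_of_nonneg_left ha0.le (by linarith) (by nlinarith)
  have hd₁ : 1 + c ≤ speed q a z₁ / speed q a y₁ := by
    rw [le_div_iff₀ (hs.pos _), hv₁, mul_div_cancel₀ _ (by linarith)]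
    exact hvz₁
  have hd₂ : speed q a z₂ / speed q a y₂ ≤ 1 := by
    rw [div_le_one (hs.pos _), hv₂]
    exact hvz₂
  have hshift : z₁ - y₁ ≤ A * 1.01 := by
    have h1 := hst.clock_base_sub hm₁ hn₁
    rw [← hφ, hφz, hφ₁, eq_div_iff ha0.ne'] at h1
    have h2 : J / Q + t - A * s - J / Q ≤ 1.01 := by nlinarith
    rw [← h1, mul_comm]
    exact mul_le_mul_of_nonneg_left h2 ha0.le
  have hz₂y₂ : y₂ ≤ z₂ := hs.le_flow ht0 y₂
  refine ⟨Real.exp (-y₂), ⟨(Real.exp_pos _).le, Real.exp_le_one_iff.2 (by linarith [hm₂.1])⟩,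
    Real.exp (-y₁), ⟨(Real.exp_pos _).le, Real.exp_le_one_iff.2 (by linarith [hm₁.1])⟩, ?_, ha0, ?_⟩
  · have e1 : Real.exp (-y₂) ≤ Real.exp (-y₁) := Real.exp_le_exp.2 (by linarith)
    have e2 : Real.exp (-y₂) = Real.exp (-y₁) * Real.exp (-(A / Q / 2)) := by
      rw [← Real.exp_add, hy₂]
      ring_nf
    have e3 := Real.add_one_le_exp (-(A / Q / 2))
    have e4 : Real.exp (-y₁) ≤ 1 := Real.exp_le_one_iff.2 (by linarith [hm₁.1])
    have e5 : A / (2 * Q) = A / Q / 2 := by field_simp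
    rw [abs_of_nonneg (sub_nonneg.2 e1), e2, e5]
    nlinarith [Real.exp_pos (-y₁)]
  · rw [(hs.hasDerivAt_halfFlow_exp t y₁).deriv, (hs.hasDerivAt_halfFlow_exp t y₂).deriv,
      ← hz₁, ← hz₂]
    have e1 : Real.exp (y₂ - z₂) * (speed q a z₂ / speed q a y₂) ≤ 1 :=
      mul_le_one₀ (Real.exp_le_one_iff.2 (by linarith)) (div_nonneg (hs.pos _).le (hs.pos _).le) hd₂
    have e2 : (1 - A * 1.01) * (1 + c) ≤ Real.exp (y₁ - z₁) * (speed q a z₁ / speed q a y₁) := by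
      have := Real.add_one_le_exp (y₁ - z₁)
      exact mul_le_mul (by linarith) hd₁ (by linarith) (Real.exp_pos _).le
    nlinarith [mul_le_mul_of_nonneg_right hq1 ha0.le, mul_pos ha0 hc0]

/-- The flow is not of class `C^2` at the times which are far from being multiples of
`1 / q N`. -/
theorem Design.not_crHalfLineDiffeo {q a δ : ℕ → ℝ} (h : Design q a δ) (hq : Tendsto q atTop atTop)
    {t : ℝ} (ht0 : 0 ≤ t) (ht1 : t ≤ 1)
    (ht : ∀ N, ∃ p : ℕ, 1 / 2 ≤ q N * t - p ∧ q N * t - p ≤ 0.7) {r : ℕ∞} (hr : 2 ≤ r) :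
    ¬ CrHalfLineDiffeo r (halfFlow (speed q a) t) := by
  intro hC
  obtain ⟨K, hK⟩ := h.isFadingSpeed.exists_lipschitz hr hC
  obtain ⟨Y, hY⟩ := eventually_atTop.1 (h.isFadingSpeed.tendsto.eventually_le_const
    (by norm_num : (0 : ℝ) < 0.005))
  obtain ⟨N, hNq, hNY⟩ := ((hq.eventually_gt_atTop |K|).and
    (tendsto_natCast_atTop_atTop.eventually_ge_atTop Y)).exists
  obtain ⟨p, hp, hp'⟩ := ht N
  obtain ⟨x, hx, z, hz, hxz, ha, hder⟩ :=
    h.exists_deriv_sub_ge ht0 ht1 (fun w hw => hY w (hNY.trans hw)) hp hp'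
  have hq1 := (h.stage N).one_le
  have h1 := (hder.trans (le_abs_self _)).trans (hK x hx z hz)
  have h2 : K * |z - x| ≤ |K| * (a N / (2 * q N)) :=
    mul_le_mul (le_abs_self K) hxz (abs_nonneg _) (abs_nonneg _)
  have h3 : |K| * (a N / (2 * q N)) < q N * a N := by
    have : a N / (2 * q N) ≤ a N := div_le_self ha.le (by linarith)
    exact (mul_le_mul_of_nonneg_left this (abs_nonneg K)).trans_lt
      (mul_lt_mul_of_pos_right hNq ha)
  linarith

section Cantor

open Cardinal

lemma cantorFunction_quarter_succ (g : ℕ → Bool) : cantorFunction (1 / 4) g =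
    (cond (g 0) 1 0 : ℝ) + 1 / 4 * cantorFunction (1 / 4) fun n => g (n + 1) :=
  cantorFunction_succ g (by norm_num) (by norm_num)

lemma cantorFunction_quarter_mem_Icc (g : ℕ → Bool) :
    cantorFunction (1 / 4) g ∈ Icc (0 : ℝ) (4 / 3) := by
  refine ⟨tsum_nonneg fun _ => cantorFunctionAux_nonneg (by norm_num), ?_⟩
  have h := cantorFunction_quarter_succ fun _ => true
  have hle : cantorFunction (1 / 4) g ≤ cantorFunction (1 / 4) fun _ => true :=
    cantorFunction_le (by norm_num) (by norm_num) fun _ _ => rfl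
  simp only [cond_true] at h
  linarith

lemma exists_pow_mul_cantorFunction_eq (g : ℕ → Bool) (m : ℕ) : ∃ p : ℕ,
    4 ^ m * cantorFunction (1 / 4) g = 4 * p + cantorFunction (1 / 4) fun n => g (n + m) := by
  induction m with
  | zero => exact ⟨0, by simp⟩
  | succ m ih =>
    obtain ⟨p, hp⟩ := ih
    rw [cantorFunction_quarter_succ fun n => g (n + m)] at hp
    refine ⟨4 * p + cond (g m) 1 0, ?_⟩
    rw [pow_succ', mul_assoc, hp]
    cases hg : g m <;> simp [hg, add_right_comm, add_assoc] <;> ring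

lemma exists_pow_mul_cantorFunction_sub_eq {g : ℕ → Bool} {m M : ℕ} (hmM : m + 1 ≤ M)
    (hg : ∀ i, m < i → i < M → g i = false) : ∃ p : ℕ,
    4 ^ M * (cantorFunction (1 / 4) g - p / 4 ^ m) = cantorFunction (1 / 4) fun n => g (n + M) := by
  obtain ⟨p, hp⟩ := exists_pow_mul_cantorFunction_eq g m
  rw [cantorFunction_quarter_succ fun n => g (n + m)] at hp
  refine ⟨4 * p + cond (g m) 1 0, ?_⟩
  induction M, hmM using Nat.le_induction with
  | base =>
    rw [mul_sub, pow_succ', mul_assoc 4, hp, mul_assoc 4, mul_div_cancel₀ _ (by positivity)]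
    cases hg : g m <;> simp [hg, add_right_comm, add_assoc] <;> ring
  | succ M hM ih =>
    have h := ih fun i hi hi' => hg i hi (hi'.trans M.lt_succ_self)
    rw [cantorFunction_quarter_succ fun n => g (n + M)] at h
    rw [pow_succ', mul_assoc, h]
    simp [hg M hM M.lt_succ_self, add_right_comm, add_assoc]

/-- The sum of the `4 ^ (-k n)` over those `n` for which `b n` holds. -/
noncomputable def lacunarySum (k : ℕ → ℕ) (b : ℕ → Bool) : ℝ :=
  cantorFunction (1 / 4) (Function.extend k b fun _ => false)

variable {k : ℕ → ℕ} {b : ℕ → Bool}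

lemma lacunarySum_mem_Icc : lacunarySum k b ∈ Icc (0 : ℝ) (4 / 3) :=
  cantorFunction_quarter_mem_Icc _

lemma lacunarySum_injective (hk : StrictMono k) : Function.Injective (lacunarySum k) :=
  (cantorFunction_injective (by norm_num) (by norm_num)).comp
    (Function.extend_injective hk.injective _)

lemma exists_lacunarySum_sub_div_mem_Icc (hk : StrictMono k) (N : ℕ) : ∃ p : ℕ,
    lacunarySum k b - p / 4 ^ k N ∈ Icc (0 : ℝ) (2 / 4 ^ k (N + 1)) := by
  obtain ⟨p, hp⟩ := exists_pow_mul_cantorFunction_sub_eq (hk N.lt_succ_self)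
    (g := Function.extend k b fun _ => false) fun i hi hi' => by
      refine Function.extend_apply' _ _ _ ?_
      rintro ⟨n, rfl⟩
      have := hk.lt_iff_lt.1 hi
      have := hk.lt_iff_lt.1 hi'
      omega
  have h := cantorFunction_quarter_mem_Icc
    fun n => Function.extend k b (fun _ => false) (n + k (N + 1))
  have h4 : (0 : ℝ) < 4 ^ k (N + 1) := by positivity
  rw [← hp, mul_comm] at h
  refine ⟨p, nonneg_of_mul_nonneg_left h.1 h4, (le_div_iff₀ h4).2 (h.2.trans (by norm_num))⟩

lemma exists_pow_mul_lacunarySum_true (hk : StrictMono k) (N : ℕ) : ∃ p : ℕ,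
    4 ^ k N * (lacunarySum k (fun _ => true) / 2) - p ∈ Icc (1 / 2 : ℝ) 0.7 := by
  obtain ⟨p, hp⟩ := exists_pow_mul_cantorFunction_eq
    (Function.extend k (fun _ => true) fun _ => false) (k N)
  rw [← lacunarySum] at hp
  have h := cantorFunction_quarter_mem_Icc
    fun n => Function.extend k (fun _ => true) (fun _ => false) (n + k N)
  have h' := cantorFunction_quarter_succ
    fun n => Function.extend k (fun _ => true) (fun _ => false) (n + k N)
  rw [zero_add, hk.injective.extend_apply, cond_true] at h'
  have h'' := cantorFunction_quarter_mem_Icc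
    fun n => Function.extend k (fun _ => true) (fun _ => false) (n + 1 + k N)
  refine ⟨2 * p, ?_, ?_⟩ <;> push_cast <;> linarith [h.2, h''.1]

end Cantor

lemma Stage.exists_slow_le {N : ℕ} {q a : ℝ} (h : Stage N q a) : ∃ δ, 0 < δ ∧ δ ≤ 1 ∧
    ∀ k ≤ N, ∀ y ∈ Icc (N : ℝ) (N + 1),
      |iteratedDeriv k (fun y => δ * (outer y * cell outer q a y)) y| ≤ Real.exp (-(N * N)) := by
  obtain ⟨M, -, hM⟩ := exists_iteratedDeriv_bound
    (contDiff_outer.mul h.isSpeed_cell_outer.smooth) N (isCompact_Icc (a := (N : ℝ)) (b := N + 1))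
  obtain ⟨δ, hδ0, hδ1, hδM⟩ := ((eventually_mem_nhdsWithin (a := (0 : ℝ)) (s := Ioi 0)).and
    ((eventually_mul_le 1 one_pos).and
      (eventually_mul_le M (Real.exp_pos (-(N * N : ℝ)))))).exists
  rw [mem_Ioi] at hδ0
  refine ⟨δ, hδ0, by simpa using hδ1, fun k hk y hy => ?_⟩
  rw [iteratedDeriv_const_mul_field, abs_mul, abs_of_pos hδ0]
  exact (mul_le_mul_of_nonneg_left (hM k hk y hy) hδ0.le).trans hδM

lemma exists_design : ∃ (k : ℕ → ℕ) (a δ : ℕ → ℝ), StrictMono k ∧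
    Design (fun N => 4 ^ k N) a δ ∧ ∀ N, 2 / 4 ^ k (N + 1) ≤ δ N := by
  choose a ha using fun N m : ℕ =>
    exists_stage N (q := 4 ^ m) (one_le_pow₀ (by norm_num))
  choose δ hδ0 hδ1 hδ using fun N m => (ha N m).exists_slow_le
  have hnext : ∀ N m : ℕ, ∃ M, m < M ∧ 2 / 4 ^ M ≤ δ N m := fun N m => by
    have h : Tendsto (fun M : ℕ => (2 : ℝ) / 4 ^ M) atTop (𝓝 0) :=
      tendsto_const_nhds.div_atTop (tendsto_pow_atTop_atTop_of_one_lt (by norm_num))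
    exact ((eventually_gt_atTop m).and (h.eventually_le_const (hδ0 N m))).exists
  choose next hlt hnext using hnext
  set k : ℕ → ℕ := fun N => Nat.rec 0 next N with hk
  exact ⟨k, fun N => a N (k N), fun N => δ N (k N), strictMono_nat_of_lt_succ fun N => hlt N (k N),
    ⟨fun N => ha N _, fun N => hδ0 N _, fun N => hδ1 N _, fun N => hδ N _⟩,
    fun N => hnext N (k N)⟩

lemma AddSubgroup.dense_of_not_countable {S : AddSubgroup ℝ} (hS : ¬ (S : Set ℝ).Countable) :
    Dense (S : Set ℝ) := by
  refine S.dense_or_cyclic.resolve_right ?_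
  rintro ⟨x, hx⟩
  refine hS ((countable_range fun n : ℤ => n • x).mono ?_)
  rw [hx]
  intro y hy
  obtain ⟨n, hn⟩ := AddSubgroup.mem_closure_singleton.1 hy
  exact ⟨n, hn⟩

/-- There exists a smooth diffeomorphism `f` of `[0,∞)`, fixing only the origin, whose
`C^1`-centralizer is an injective one-parameter group `{f^t}` (the flow of a complete `C^1`
vector field `ξ` vanishing only at `0`, with time-one map `f`), and such that for every
`2 ≤ r ≤ ∞` the set of times `t` for which `f^t` is a `C^r` diffeomorphism is a proper,
dense and uncountable additive subgroup of `ℝ`. -/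
theorem statement0 :
    ∃ f : ℝ → ℝ, CrHalfLineDiffeo ⊤ f ∧ f 0 = 0 ∧ (∀ x : ℝ, 0 < x → f x ≠ x) ∧
      ∃ (ξ : ℝ → ℝ) (F : ℝ → ℝ → ℝ),
        ContDiffOn ℝ 1 ξ (Set.Ici 0) ∧
        ξ 0 = 0 ∧ (∀ x : ℝ, 0 < x → ξ x ≠ 0) ∧
        IsFlowOf ξ F ∧
        (∀ x ∈ Set.Ici (0 : ℝ), F 1 x = f x) ∧
        (∀ s t : ℝ, Set.EqOn (F s) (F t) (Set.Ici 0) → s = t) ∧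
        Centralizer 1 f = {g : ℝ → ℝ | ∃ t : ℝ, Set.EqOn g (F t) (Set.Ici 0)} ∧
        (∀ r : ℕ∞, 2 ≤ r →
          (Centralizer r f
              = {g : ℝ → ℝ | ∃ t : ℝ, CrHalfLineDiffeo r (F t) ∧
                  Set.EqOn g (F t) (Set.Ici 0)} ∧
            ∃ S : AddSubgroup ℝ,
              (S : Set ℝ) = {t : ℝ | CrHalfLineDiffeo r (F t)} ∧
              (S : Set ℝ) ≠ Set.univ ∧ Dense (S : Set ℝ) ∧
              ¬ (S : Set ℝ).Countable)) := by
  have : Uncountable (ℕ → Bool) := Cardinal.aleph0_lt_mk_iff.1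
    (by simp [Cardinal.aleph0_lt_continuum])
  obtain ⟨k, a, δ, hk, h, hδ⟩ := exists_design
  set q : ℕ → ℝ := fun N => 4 ^ k N with hq
  have hqt : Tendsto q atTop atTop :=
    (tendsto_pow_atTop_atTop_of_one_lt (by norm_num)).comp hk.tendsto_atTop
  have hv := h.isFadingSpeed
  have hslow : ∀ (b : ℕ → Bool) (r : ℕ∞),
      CrHalfLineDiffeo r (halfFlow (speed q a) (lacunarySum k b)) := fun b r =>
    h.crHalfLineDiffeo lacunarySum_mem_Icc.1 (lacunarySum_mem_Icc.2.trans (by norm_num))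
      (fun N => by
        obtain ⟨p, hp⟩ := exists_lacunarySum_sub_div_mem_Icc (b := b) hk N
        exact ⟨p, hp.1, hp.2.trans (hδ N)⟩) r
  have hone : CrHalfLineDiffeo ⊤ (halfFlow (speed q a) 1) :=
    h.crHalfLineDiffeo zero_le_one one_le_two (fun N => ⟨4 ^ k N, by
      have : (1 : ℝ) - (4 ^ k N : ℕ) / q N = 0 := by
        rw [hq, Nat.cast_pow, Nat.cast_ofNat, div_self (by positivity), sub_self]
      rw [this]
      exact ⟨le_rfl, (h.pos N).le⟩⟩) ⊤
  refine ⟨halfFlow (speed q a) 1, hone, hone.1.1, fun x hx => hv.halfFlow_ne_self one_ne_zero hx,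
    halfField (speed q a), halfFlow (speed q a), hv.contDiff_halfField.contDiffOn,
    IsFadingSpeed.halfField_zero, fun x hx => hv.halfField_ne_zero hx, hv.isFlowOf,
    fun x _ => rfl, fun s t => hv.halfFlow_injective, hv.centralizer_one_eq, fun r hr =>
    ⟨hv.centralizer_eq (one_le_two.trans hr), hv.smoothTimes r, rfl, fun huniv => ?_, ?_⟩⟩
  · have hmem : lacunarySum k (fun _ => true) / 2 ∈ (hv.smoothTimes r : Set ℝ) :=
      huniv ▸ mem_univ _
    have hc := lacunarySum_mem_Icc (k := k) (b := fun _ => true)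
    exact h.not_crHalfLineDiffeo hqt (by linarith [hc.1]) (by linarith [hc.2])
      (exists_pow_mul_lacunarySum_true hk) hr hmem
  · have hS : ¬ (hv.smoothTimes r : Set ℝ).Countable := fun hS =>
      not_countable_univ ((mapsTo_univ_iff.2 fun b => hslow b r).countable_of_injOn
        (lacunarySum_injective hk).injOn hS)
    exact ⟨AddSubgroup.dense_of_not_countable hS, hS⟩
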